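/- For every integer R ≥ 2 there exists a constant c(R) (depending only on R) such that every (Q_o,m₁,m₂)-set 𝒬̃ ⊆ ℂ[x₁,…,xₙ] with 2 ≤ rank_s(Q_o) ≤ R satisfies dim span_ℂ 𝒬̃ ≤ c(R). -/

import Mathlib

open MvPolynomial

/-- `rankS Q` is the minimal `r` such that `Q = ∑_{i=1}^r a_i · b_i` for linear forms
`a_i, b_i`. -/
noncomputable def rankS {σ : Type*} (Q : MvPolynomial σ ℂ) : ℕ :=
  sInf {r : ℕ | ∃ a b : Fin r → MvPolynomial σ ℂ,
    (∀ i, (a i).IsHomogeneous 1) ∧ (∀ i, (b i).IsHomogeneous 1) ∧ Q = ∑ i, a i * b i}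

/-- The family of all polynomials of a `(Q_o,m₁,m₂)`-set: `Q_o`, the `Q_j`'s, the `P_i`'s
and the squares `ℓ_t²`. -/
noncomputable def QoFam {n m₁ m₂ r : ℕ} (Qo : MvPolynomial (Fin n) ℂ)
    (Qs : Fin m₁ → MvPolynomial (Fin n) ℂ) (Ps : Fin m₂ → MvPolynomial (Fin n) ℂ)
    (ls : Fin r → MvPolynomial (Fin n) ℂ) :
    Unit ⊕ Fin m₁ ⊕ Fin m₂ ⊕ Fin r → MvPolynomial (Fin n) ℂ :=
  Sum.elim (fun _ => Qo) (Sum.elim Qs (Sum.elim Ps fun t => ls t ^ 2))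

/-- `𝒬̃ = {Q_o} ∪ {Q_j} ∪ {P_i} ∪ {ℓ_t²}` is a `(Q_o,m₁,m₂)`-set (Definition 4.4 of the
paper). -/
def IsQoSet {n : ℕ} (m₁ m₂ r : ℕ) (Qo : MvPolynomial (Fin n) ℂ)
    (Qs : Fin m₁ → MvPolynomial (Fin n) ℂ) (Ps : Fin m₂ → MvPolynomial (Fin n) ℂ)
    (ls : Fin r → MvPolynomial (Fin n) ℂ) : Prop :=
  -- the members of 𝒬₁ and 𝒬₂ are irreducible homogeneous quadratics, the ℓ_t are linear
  (Qo.IsHomogeneous 2 ∧ Irreducible Qo) ∧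
  (∀ j, (Qs j).IsHomogeneous 2 ∧ Irreducible (Qs j)) ∧
  (∀ i, (Ps i).IsHomogeneous 2 ∧ Irreducible (Ps i)) ∧
  (∀ t, (ls t).IsHomogeneous 1) ∧
  -- (1) pairwise linear independence and the vanishing (radical-membership) condition
  (∀ i j, i ≠ j →
    LinearIndependent ℂ ![QoFam Qo Qs Ps ls i, QoFam Qo Qs Ps ls j]) ∧
  (∀ i j, i ≠ j →
    (∏ k ∈ (Finset.univ.erase i).erase j, QoFam Qo Qs Ps ls k) ∈
      (Ideal.span {QoFam Qo Qs Ps ls i, QoFam Qo Qs Ps ls j}).radical) ∧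
  -- (2)
  (5 * m₂ + 2 < m₁) ∧
  -- (3)
  (∀ j, ∃ a b : MvPolynomial (Fin n) ℂ,
    a.IsHomogeneous 1 ∧ b.IsHomogeneous 1 ∧ Qs j = Qo + a * b) ∧
  -- (4)
  (∀ i, ∀ α β : ℂ, ¬(α = 0 ∧ β = 0) → 2 ≤ rankS (α • Ps i + β • Qo)) ∧
  -- (5)
  Set.ncard {i : Unit ⊕ Fin m₁ ⊕ Fin m₂ |
    ∃ c d : MvPolynomial (Fin n) ℂ, c.IsHomogeneous 1 ∧ d.IsHomogeneous 1 ∧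
      Sum.elim (fun _ => Qo) (Sum.elim Qs Ps) i ∈ Ideal.span {c, d} ∧
      Qo ∈ Ideal.span {c, d}} ≤ m₂

theorem exists_approx_scaling {R X : Type*} [Fintype R] [Fintype X] [DecidableEq X]
    (b : R → X → ℝ) (m : R → ℝ) (hm : ∀ r, 0 ≤ m r) (s : R → Finset X)
    (hpos : ∀ r x, x ∈ s r → 0 < b r x) (hzero : ∀ r x, x ∉ s r → b r x = 0)
    (hne : ∀ r, (s r).Nonempty) {ε : ℝ} (hε : 0 < ε) :
    ∃ u : X → ℝ, ∀ x,
      |(∑ r, m r * ((s r).card * ((b r x * Real.exp (u x)) / ∑ y, b r y * Real.exp (u y))))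
        - ∑ r, m r * (if x ∈ s r then (1 : ℝ) else 0)| ≤ ε := by
  have hb : ∀ r x, 0 ≤ b r x := fun r x => by
    by_cases h : x ∈ s r
    · exact (hpos r x h).le
    · exact (hzero r x h).ge
  have hS : ∀ r (u : X → ℝ), 0 < ∑ y, b r y * Real.exp (u y) := fun r u => by
    obtain ⟨x, hx⟩ := hne r
    exact Finset.sum_pos' (fun y _ => mul_nonneg (hb r y) (Real.exp_pos _).le)
      ⟨x, Finset.mem_univ _, mul_pos (hpos r x hx) (Real.exp_pos _)⟩
  set g : R → (X → ℝ) → ℝ := fun r u =>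
    (s r).card * Real.log (∑ y, b r y * Real.exp (u y)) - ∑ x ∈ s r, u x with hg
  have hglow : ∀ r u, ∑ x ∈ s r, Real.log (b r x) ≤ g r u := by
    intro r u
    have : ∑ x ∈ s r, (Real.log (b r x) + u x)
        ≤ ∑ x ∈ s r, Real.log (∑ y, b r y * Real.exp (u y)) := by
      refine Finset.sum_le_sum fun x hx => ?_
      rw [← Real.log_exp (u x), ← Real.log_mul (hpos r x hx).ne' (Real.exp_pos _).ne']
      refine Real.log_le_log (mul_pos (hpos r x hx) (Real.exp_pos _)) ?_
      exact Finset.single_le_sum (f := fun y => b r y * Real.exp (u y))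
        (fun y _ => mul_nonneg (hb r y) (Real.exp_pos _).le) (Finset.mem_univ x)
    rw [Finset.sum_add_distrib, Finset.sum_const, nsmul_eq_mul] at this
    simp only [hg]; linarith
  set B : ℝ := ∑ r, m r * ∑ x ∈ s r, Real.log (b r x) with hB
  have hlow : ∀ u, B ≤ ∑ r, m r * g r u := fun u =>
    Finset.sum_le_sum fun r _ => mul_le_mul_of_nonneg_left (hglow r u) (hm r)
  set N : ℝ := (∑ r, m r * g r 0) - B with hN
  have hN0 : 0 ≤ N := by have := hlow 0; linarith
  set η : ℝ := ε ^ 2 / (4 * (N + 1)) with hη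
  have hη0 : 0 < η := by positivity
  set f : (X → ℝ) → ℝ := fun u => (∑ r, m r * g r u) + η * ∑ x, u x ^ 2 with hf
  have hcont : Continuous f := by
    simp only [hf, hg]
    refine Continuous.add (continuous_finsetSum _ fun r _ => ?_) (by fun_prop)
    refine continuous_const.mul (Continuous.sub (continuous_const.mul ?_) (by fun_prop))
    exact Continuous.log (by fun_prop) fun u => (hS r u).ne'
  have hf0 : f 0 = B + N := by simp [hf, hN]
  obtain ⟨u, hu⟩ : ∃ u, ∀ w, f u ≤ f w := by
    refine hcont.exists_forall_le' 0 ?_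
    have h1 := (tendsto_norm_cocompact_atTop (E := X → ℝ)).eventually_ge_atTop
      (Real.sqrt (N / η))
    filter_upwards [h1] with w hw
    have hw2 : N / η ≤ ‖w‖ ^ 2 := by
      rw [← Real.sq_sqrt (show 0 ≤ N / η by positivity)]
      exact pow_le_pow_left₀ (Real.sqrt_nonneg _) hw 2
    have hsq : ‖w‖ ^ 2 ≤ ∑ x, w x ^ 2 := by
      have : ‖w‖ ≤ Real.sqrt (∑ x, w x ^ 2) := by
        refine (pi_norm_le_iff_of_nonneg (Real.sqrt_nonneg _)).2 fun x => ?_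
        refine Real.le_sqrt_of_sq_le ?_
        rw [Real.norm_eq_abs, sq_abs]
        exact Finset.single_le_sum (f := fun x => w x ^ 2) (fun y _ => sq_nonneg _)
          (Finset.mem_univ x)
      calc ‖w‖ ^ 2 ≤ (Real.sqrt (∑ x, w x ^ 2)) ^ 2 := pow_le_pow_left₀ (norm_nonneg _) this 2
        _ = _ := Real.sq_sqrt (Finset.sum_nonneg fun _ _ => sq_nonneg _)
    have h3 : N ≤ η * ∑ x, w x ^ 2 := by
      rw [div_le_iff₀ hη0] at hw2
      nlinarith
    have := hlow w
    rw [hf0]; simp only [hf]; linarith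
  refine ⟨u, fun x => ?_⟩
  have hbound : η * u x ^ 2 ≤ N := by
    have h1 := hu 0
    rw [hf0] at h1
    have h2 := hlow u
    have h3 : u x ^ 2 ≤ ∑ x, u x ^ 2 :=
      Finset.single_le_sum (f := fun x => u x ^ 2) (fun y _ => sq_nonneg _) (Finset.mem_univ x)
    simp only [hf] at h1
    nlinarith
  have hderiv : HasDerivAt (fun t : ℝ => f (fun y => u y + t * (if y = x then (1 : ℝ) else 0)))
      ((∑ r, m r * ((s r).card * ((b r x * Real.exp (u x)) / ∑ y, b r y * Real.exp (u y))
        - (if x ∈ s r then (1 : ℝ) else 0))) + η * (2 * u x)) 0 := by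
    have hcoord : ∀ y : X, HasDerivAt (fun t : ℝ => (u y + t * (if y = x then (1 : ℝ) else 0)))
        (if y = x then (1 : ℝ) else 0) 0 := by
      intro y
      simpa using ((hasDerivAt_id (0 : ℝ)).mul_const (if y = x then (1 : ℝ) else 0)).const_add (u y)
    simp only [hf, hg]
    refine HasDerivAt.add (HasDerivAt.fun_sum fun r _ => ?_) ?_
    · refine HasDerivAt.const_mul _ (HasDerivAt.sub (HasDerivAt.const_mul _ ?_) ?_)
      · have h1 : HasDerivAt (fun t : ℝ =>
            ∑ y, b r y * Real.exp ((u y + t * (if y = x then (1 : ℝ) else 0))))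
            (∑ y, b r y * (Real.exp (u y) * (if y = x then (1 : ℝ) else 0))) 0 := by
          refine HasDerivAt.fun_sum fun y _ => HasDerivAt.const_mul _ ?_
          have := (hcoord y).exp
          simpa using this
        have h2 := h1.log (by simpa using (hS r u).ne')
        simpa using h2
      · have h1 : HasDerivAt (fun t : ℝ => ∑ y ∈ s r, (u y + t * (if y = x then (1 : ℝ) else 0)))
            (∑ y ∈ s r, (if y = x then (1 : ℝ) else 0)) 0 :=
          HasDerivAt.fun_sum fun y _ => hcoord y
        simpa using h1
    · refine HasDerivAt.const_mul _ ?_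
      have h1 : HasDerivAt (fun t : ℝ => ∑ y, (u y + t * (if y = x then (1 : ℝ) else 0)) ^ 2)
          (∑ y, (2 * u y * (if y = x then (1 : ℝ) else 0))) 0 := by
        refine HasDerivAt.fun_sum fun y _ => ?_
        have := (hcoord y).fun_pow 2
        simpa using this
      simpa using h1
  have hmin : IsLocalMin (fun t : ℝ => f (fun y => u y + t * (if y = x then (1 : ℝ) else 0))) 0 :=
    Filter.Eventually.of_forall fun t => by simpa using hu _
  have h0 := hmin.hasDerivAt_eq_zero hderiv
  simp only [mul_sub, Finset.sum_sub_distrib] at h0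
  have h4 : (∑ r, m r * ((s r).card * ((b r x * Real.exp (u x)) / ∑ y, b r y * Real.exp (u y))))
        - ∑ r, m r * (if x ∈ s r then (1 : ℝ) else 0) = -(η * (2 * u x)) := by linarith
  rw [h4, abs_neg]
  refine abs_le_of_sq_le_sq ?_ hε.le
  have h5 : η * (4 * (N + 1)) = ε ^ 2 := by rw [hη]; field_simp
  nlinarith [mul_le_mul_of_nonneg_left hbound hη0.le]

open scoped Matrix in
theorem finrank_mul_sq_le_of_mulVec_eq_zero {R X : Type*} [Fintype R] [Fintype X] [DecidableEq X]
    (A : Matrix R X ℂ) (W : Submodule ℂ (X → ℂ)) (hW : ∀ w ∈ W, A *ᵥ w = 0)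
    {l T : ℝ} (hl : 0 < l) (hdiag : ∀ x, l ≤ ∑ r, ‖A r x‖ ^ 2)
    (hT : ∑ x, ∑ y, (if x = y then 0 else ∑ r, ‖A r x‖ * ‖A r y‖) ^ 2 ≤ T) :
    Module.finrank ℂ W * l ^ 2 ≤ T := by
  set e := (WithLp.linearEquiv 2 ℂ (X → ℂ)).symm with he
  set W' : Submodule ℂ (EuclideanSpace ℂ X) := W.map e.toLinearMap with hW'
  have hfr : Module.finrank ℂ W' = Module.finrank ℂ W := LinearEquiv.finrank_map_eq e W
  set D := Module.finrank ℂ W' with hD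
  let bs := stdOrthonormalBasis ℂ W'
  let B : Matrix (Fin D) X ℂ := fun k x => star ((bs k : EuclideanSpace ℂ X) x)
  have hBH : ∀ x k, Bᴴ x k = (bs k : EuclideanSpace ℂ X) x := fun x k => star_star _
  have hBB : B * Bᴴ = 1 := by
    ext k l
    have h1 := orthonormal_iff_ite.1 bs.orthonormal k l
    rw [Matrix.mul_apply, Matrix.one_apply, ← h1]
    simp only [Submodule.coe_inner, PiLp.inner_apply, hBH]
    refine Finset.sum_congr rfl fun x _ => ?_
    simp [B, mul_comm]
  have hAB : A * Bᴴ = 0 := by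
    ext r k
    have hmem : (fun x => (bs k : EuclideanSpace ℂ X) x) ∈ W := by
      obtain ⟨w, hw, hwe⟩ := (bs k).2
      have : (fun x => (bs k : EuclideanSpace ℂ X) x) = w := by
        rw [← hwe]; rfl
      rwa [this]
    have := congrFun (hW _ hmem) r
    rw [Matrix.mul_apply]; simp only [hBH]; exact this
  set G : Matrix X X ℂ := Bᴴ * B with hG
  have hGG : G * G = G := by
    rw [hG, Matrix.mul_assoc, ← Matrix.mul_assoc B, hBB, Matrix.one_mul]
  have hGh : Gᴴ = G := by rw [hG, Matrix.conjTranspose_mul, Matrix.conjTranspose_conjTranspose]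
  have htr : G.trace = D := by
    rw [hG, Matrix.trace_mul_comm, hBB, Matrix.trace_one, Fintype.card_fin]
  have hAG : (Aᴴ * A * G).trace = 0 := by
    rw [hG, Matrix.mul_assoc, ← Matrix.mul_assoc A, hAB]; simp
  have hGre : ∀ x, 0 ≤ (G x x).re := by
    intro x
    rw [hG, Matrix.mul_apply, Complex.re_sum]
    refine Finset.sum_nonneg fun k _ => ?_
    rw [Matrix.conjTranspose_apply, Complex.star_def, ← Complex.normSq_eq_conj_mul_self]
    exact_mod_cast Complex.normSq_nonneg _
  have hGim : ∀ x, G x x = ((G x x).re : ℂ) := fun x => by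
    have := congrFun (congrFun hGh x) x
    exact ((Complex.conj_eq_iff_re).1 this).symm
  have hGsum : ∑ x, (G x x).re = D := by
    have := congrArg Complex.re htr
    simpa [Matrix.trace] using this
  have hGnorm : ∑ x, ∑ y, ‖G x y‖ ^ 2 = D := by
    have h1 : (∑ x, ∑ y, ((‖G x y‖ ^ 2 : ℝ) : ℂ)) = D := by
      rw [← htr]
      conv_rhs => rw [← hGG, Matrix.trace]
      refine Finset.sum_congr rfl fun x _ => ?_
      rw [Matrix.diag_apply, Matrix.mul_apply]
      refine Finset.sum_congr rfl fun y _ => ?_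
      have : G y x = star (G x y) := by
        conv_lhs => rw [← hGh]
        rfl
      rw [this, Complex.star_def, Complex.mul_conj, Complex.normSq_eq_norm_sq]
    exact_mod_cast h1
  set M := Aᴴ * A with hM
  have hMd : ∀ x, M x x = ((∑ r, ‖A r x‖ ^ 2 : ℝ) : ℂ) := by
    intro x
    rw [hM, Matrix.mul_apply]
    push_cast
    refine Finset.sum_congr rfl fun r _ => ?_
    rw [Matrix.conjTranspose_apply, Complex.star_def, ← Complex.normSq_eq_conj_mul_self,
      Complex.normSq_eq_norm_sq]
    push_cast; rfl
  set N : X → X → ℝ := fun x y => if x = y then 0 else ∑ r, ‖A r x‖ * ‖A r y‖ with hN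
  have hMN : ∀ x y, x ≠ y → ‖M x y‖ ≤ N x y := by
    intro x y hxy
    simp only [hN, if_neg hxy]
    rw [hM, Matrix.mul_apply]
    refine (norm_sum_le _ _).trans (Finset.sum_le_sum fun r _ => ?_)
    simp [Matrix.conjTranspose_apply]
  have hN0 : ∀ x y, 0 ≤ N x y := by
    intro x y
    simp only [hN]
    split_ifs
    · exact le_rfl
    · exact Finset.sum_nonneg fun r _ => by positivity
  have key : l * D ≤ ∑ x, ∑ y, N x y * ‖G y x‖ := by
    have h1 : (M * G).trace = ∑ x, ∑ y, M x y * G y x := by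
      simp [Matrix.trace, Matrix.mul_apply]
    rw [hAG] at h1
    have h2 : ∑ x, M x x * G x x = - ∑ x, ∑ y ∈ Finset.univ.erase x, M x y * G y x := by
      rw [eq_neg_iff_add_eq_zero, ← Finset.sum_add_distrib, h1]
      exact Finset.sum_congr rfl fun x _ =>
        (Finset.add_sum_erase _ (fun y => M x y * G y x) (Finset.mem_univ x))
    have h3 : ∑ x, M x x * G x x = ((∑ x, (∑ r, ‖A r x‖ ^ 2) * (G x x).re : ℝ) : ℂ) := by
      push_cast
      refine Finset.sum_congr rfl fun x _ => ?_
      rw [hMd x]; conv_lhs => rw [hGim x]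
      push_cast; rfl
    have h4 : l * D ≤ ∑ x, (∑ r, ‖A r x‖ ^ 2) * (G x x).re := by
      rw [← hGsum, Finset.mul_sum]
      exact Finset.sum_le_sum fun x _ => mul_le_mul_of_nonneg_right (hdiag x) (hGre x)
    refine h4.trans ?_
    calc _ ≤ ‖((∑ x, (∑ r, ‖A r x‖ ^ 2) * (G x x).re : ℝ) : ℂ)‖ := by
          rw [Complex.norm_real]; exact le_abs_self _
      _ = ‖∑ x, ∑ y ∈ Finset.univ.erase x, M x y * G y x‖ := by rw [← h3, h2, norm_neg]
      _ ≤ ∑ x, ∑ y ∈ Finset.univ.erase x, N x y * ‖G y x‖ := by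
          refine (norm_sum_le _ _).trans (Finset.sum_le_sum fun x _ => ?_)
          refine (norm_sum_le _ _).trans (Finset.sum_le_sum fun y hy => ?_)
          rw [norm_mul]
          exact mul_le_mul_of_nonneg_right (hMN x y (Finset.ne_of_mem_erase hy).symm)
            (norm_nonneg _)
      _ ≤ _ := Finset.sum_le_sum fun x _ =>
          Finset.sum_le_sum_of_subset_of_nonneg (Finset.erase_subset _ _)
            fun y _ _ => mul_nonneg (hN0 x y) (norm_nonneg _)
  have cs : (∑ x, ∑ y, N x y * ‖G y x‖) ^ 2 ≤ T * D := by
    have := Finset.sum_mul_sq_le_sq_mul_sq (Finset.univ : Finset (X × X))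
      (fun p => N p.1 p.2) (fun p => ‖G p.2 p.1‖)
    rw [Fintype.sum_prod_type, Fintype.sum_prod_type, Fintype.sum_prod_type] at this
    refine this.trans ?_
    have h5 : ∑ x, ∑ y, ‖G y x‖ ^ 2 = D := by rw [Finset.sum_comm]; exact hGnorm
    simp only [h5]
    exact mul_le_mul_of_nonneg_right hT (Nat.cast_nonneg _)
  rw [← hfr]
  have hD0 : (0 : ℝ) ≤ D := Nat.cast_nonneg _
  rcases hD0.eq_or_lt with h | h
  · rw [← h, zero_mul]
    exact le_trans (Finset.sum_nonneg fun x _ => Finset.sum_nonneg fun y _ => sq_nonneg _) hT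
  · have : (l * D) ^ 2 ≤ T * D := (pow_le_pow_left₀ (by positivity) key 2).trans cs
    have h6 : (D * l ^ 2) * D ≤ T * D := by nlinarith
    exact le_of_mul_le_mul_right h6 h

/-- A triple of pairwise distinct indices whose vectors span a plane. -/
def CollinearTriple {X E : Type*} [AddCommGroup E] [Module ℂ E] (v : X → E) (t : X × X × X) :
    Prop :=
  t.1 ≠ t.2.1 ∧ t.2.2 ≠ t.1 ∧ t.2.2 ≠ t.2.1 ∧ v t.2.2 ∈ Submodule.span ℂ {v t.1, v t.2.1}

theorem CollinearTriple.exists_relation {X E : Type*} [DecidableEq X] [AddCommGroup E] [Module ℂ E]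
    [Fintype X] {v : X → E} (hv : ∀ x y, x ≠ y → LinearIndependent ℂ ![v x, v y])
    {t : X × X × X} (ht : CollinearTriple v t) :
    ∃ a : X → ℂ, (∀ x, a x ≠ 0 ↔ x ∈ ({t.1, t.2.1, t.2.2} : Finset X)) ∧ ∑ x, a x • v x = 0 := by
  obtain ⟨x, y, z⟩ := t
  obtain ⟨hxy, hzx, hzy, hmem⟩ := ht
  simp only at hxy hzx hzy hmem ⊢
  obtain ⟨α, β, hab⟩ := Submodule.mem_span_pair.1 hmem
  have hα : α ≠ 0 := by
    rintro rfl
    have := (LinearIndependent.pair_iff.1 (hv y z hzy.symm)) β (-1) (by simp [← hab])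
    simpa using this.2
  have hβ : β ≠ 0 := by
    rintro rfl
    have := (LinearIndependent.pair_iff.1 (hv x z hzx.symm)) α (-1) (by simp [← hab])
    simpa using this.2
  refine ⟨fun w => (if w = x then α else 0) + (if w = y then β else 0) +
    (if w = z then -1 else 0), fun w => ?_, ?_⟩
  · simp only [Finset.mem_insert, Finset.mem_singleton]
    by_cases h1 : w = x
    · subst h1; simp [hxy, hzx.symm, hα]
    · by_cases h2 : w = y
      · subst h2; simp [h1, hzy.symm, hβ]
      · by_cases h3 : w = z
        · subst h3; simp [h1, h2]
        · simp [h1, h2, h3]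
  · simp only [add_smul, ite_smul, zero_smul, Finset.sum_add_distrib, Finset.sum_ite_eq',
      Finset.mem_univ, if_true]
    rw [hab]; simp

theorem CollinearTriple.span_eq {X E : Type*} [DecidableEq X] [AddCommGroup E] [Module ℂ E]
    {v : X → E} (hv : ∀ x y, x ≠ y → LinearIndependent ℂ ![v x, v y])
    {t : X × X × X} (ht : CollinearTriple v t) {a b : X}
    (ha : a ∈ ({t.1, t.2.1, t.2.2} : Finset X)) (hb : b ∈ ({t.1, t.2.1, t.2.2} : Finset X))
    (hab : a ≠ b) :
    Submodule.span ℂ {v a, v b} = Submodule.span ℂ {v t.1, v t.2.1} := by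
  have hmem : ∀ c ∈ ({t.1, t.2.1, t.2.2} : Finset X), v c ∈ Submodule.span ℂ {v t.1, v t.2.1} := by
    intro c hc
    simp only [Finset.mem_insert, Finset.mem_singleton] at hc
    rcases hc with rfl | rfl | rfl
    · exact Submodule.subset_span (by simp)
    · exact Submodule.subset_span (by simp)
    · exact ht.2.2.2
  have hfr : ∀ c d : X, c ≠ d → Module.finrank ℂ (Submodule.span ℂ {v c, v d}) = 2 := by
    intro c d hcd
    have := finrank_span_eq_card (hv c d hcd)
    have hr : Set.range ![v c, v d] = {v c, v d} := by
      simp [Matrix.range_cons, Set.pair_comm (v d)]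
    rw [hr] at this
    simpa using this
  have : FiniteDimensional ℂ (Submodule.span ℂ {v t.1, v t.2.1}) :=
    FiniteDimensional.span_of_finite ℂ (by simp)
  refine Submodule.eq_of_le_of_finrank_eq ?_ ?_
  · rw [Submodule.span_le]
    rintro _ (rfl | rfl)
    exacts [hmem a ha, hmem b hb]
  · rw [hfr a b hab, hfr _ _ ht.1]

theorem finrank_span_le_of_collinearTriples {X E : Type*} [Fintype X] [DecidableEq X]
    [AddCommGroup E] [Module ℂ E] (v : X → E)
    (hv : ∀ x y, x ≠ y → LinearIndependent ℂ ![v x, v y]) {δ : ℝ} (hδ : 0 < δ)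
    (hspecial : ∀ x, ∃ Y : Finset X, δ * Fintype.card X ≤ Y.card ∧
      ∀ y ∈ Y, ∃ z, CollinearTriple v (x, y, z)) :
    Module.finrank ℂ (Submodule.span ℂ (Set.range v)) * δ ^ 2 ≤ 2916 := by
  classical
  rcases isEmpty_or_nonempty X with hX | hX
  · rw [Set.range_eq_empty, Submodule.span_empty, finrank_bot]; norm_num
  set n : ℝ := (Fintype.card X : ℝ) with hn
  have hn0 : 0 < n := by rw [hn]; exact_mod_cast Fintype.card_pos
  set R := {t : X × X × X // CollinearTriple v t} with hR
  set line : X → X → Finset X := fun x y =>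
    Finset.univ.filter fun z => v z ∈ Submodule.span ℂ {v x, v y} with hline
  set s : R → Finset X := fun t => {t.1.1, t.1.2.1, t.1.2.2} with hs
  have hscard : ∀ t, (s t).card = 3 := fun t => by
    obtain ⟨h1, h2, h3, -⟩ := t.2
    exact Finset.card_eq_three.2 ⟨_, _, _, h1, h2.symm, h3.symm, rfl⟩
  set m : R → ℝ := fun t => ((line t.1.1 t.1.2.1).card : ℝ)⁻¹ with hm
  choose a ha hrel using fun t : R => t.2.exists_relation hv
  have hm0 : ∀ t, 0 ≤ m t := fun t => by positivity
  -- pair sums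
  have hpair : ∀ x y, x ≠ y → ∑ t, m t * (if x ∈ s t ∧ y ∈ s t then 1 else 0) ≤ 6 := by
    intro x y hxy
    have hmt : ∀ t : R, x ∈ s t ∧ y ∈ s t → m t = ((line x y).card : ℝ)⁻¹ := by
      rintro t ⟨hx, hy⟩
      simp only [hm, hline]
      rw [CollinearTriple.span_eq hv t.2 hx hy hxy]
    set F : Finset R := Finset.univ.filter fun t => x ∈ s t ∧ y ∈ s t with hF
    have hcard : F.card ≤ 6 * (line x y).card := by
      have hsub : F.image Subtype.val ⊆ (line x y).image (fun w => (x, y, w)) ∪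
          (line x y).image (fun w => (y, x, w)) ∪ (line x y).image (fun w => (x, w, y)) ∪
          (line x y).image (fun w => (y, w, x)) ∪ (line x y).image (fun w => (w, x, y)) ∪
          (line x y).image (fun w => (w, y, x)) := by
        intro t0 ht0
        obtain ⟨t, ht, rfl⟩ := Finset.mem_image.1 ht0
        obtain ⟨hx, hy⟩ := (Finset.mem_filter.1 ht).2
        have hl : ∀ w ∈ s t, w ∈ line x y := by
          intro w hw
          refine Finset.mem_filter.2 ⟨Finset.mem_univ _, ?_⟩
          rw [CollinearTriple.span_eq hv t.2 hx hy hxy]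
          simp only [hs, Finset.mem_insert, Finset.mem_singleton] at hw
          rcases hw with rfl | rfl | rfl
          · exact Submodule.subset_span (by simp)
          · exact Submodule.subset_span (by simp)
          · exact t.2.2.2.2
        obtain ⟨⟨p, q, w⟩, htv⟩ := t
        simp only [hs, Finset.mem_insert, Finset.mem_singleton] at hx hy hl
        simp only [Finset.mem_union, Finset.mem_image, Prod.mk.injEq]
        have hp := hl p (by simp)
        have hq := hl q (by simp)
        have hw := hl w (by simp)
        clear hl ht ht0
        rcases hx with rfl | rfl | rfl <;> rcases hy with rfl | rfl | rfl <;>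
          simp_all
      rw [← Finset.card_image_of_injective F Subtype.val_injective]
      refine (Finset.card_le_card hsub).trans ?_
      refine (Finset.card_union_le _ _).trans ?_
      have h6 := Finset.card_image_le (s := line x y) (f := fun w => (w, y, x))
      have h5 := Finset.card_image_le (s := line x y) (f := fun w => (w, x, y))
      have h4 := Finset.card_image_le (s := line x y) (f := fun w => (y, w, x))
      have h3 := Finset.card_image_le (s := line x y) (f := fun w => (x, w, y))
      have h2 := Finset.card_image_le (s := line x y) (f := fun w => (y, x, w))
      have h1 := Finset.card_image_le (s := line x y) (f := fun w => (x, y, w))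
      have g2 := Finset.card_union_le ((line x y).image (fun w => (x, y, w)))
          ((line x y).image (fun w => (y, x, w)))
      have g3 := Finset.card_union_le ((line x y).image (fun w => (x, y, w)) ∪
          (line x y).image (fun w => (y, x, w))) ((line x y).image (fun w => (x, w, y)))
      have g4 := Finset.card_union_le ((line x y).image (fun w => (x, y, w)) ∪
          (line x y).image (fun w => (y, x, w)) ∪ (line x y).image (fun w => (x, w, y)))
          ((line x y).image (fun w => (y, w, x)))
      have g5 := Finset.card_union_le ((line x y).image (fun w => (x, y, w)) ∪
          (line x y).image (fun w => (y, x, w)) ∪ (line x y).image (fun w => (x, w, y)) ∪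
          (line x y).image (fun w => (y, w, x))) ((line x y).image (fun w => (w, x, y)))
      omega
    have hpos : 0 < ((line x y).card : ℝ) := by
      have : x ∈ line x y := Finset.mem_filter.2 ⟨Finset.mem_univ _,
        Submodule.subset_span (by simp)⟩
      exact_mod_cast Finset.card_pos.2 ⟨x, this⟩
    calc ∑ t, m t * (if x ∈ s t ∧ y ∈ s t then (1 : ℝ) else 0)
        = ∑ t ∈ F, ((line x y).card : ℝ)⁻¹ := by
          rw [Finset.sum_filter]
          refine Finset.sum_congr rfl fun t _ => ?_
          split_ifs with h
          · rw [hmt t h, mul_one]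
          · simp
      _ = F.card * ((line x y).card : ℝ)⁻¹ := by rw [Finset.sum_const, nsmul_eq_mul]
      _ ≤ (6 * (line x y).card : ℝ) * ((line x y).card : ℝ)⁻¹ := by
          refine mul_le_mul_of_nonneg_right (by exact_mod_cast hcard) (by positivity)
      _ = 6 := by field_simp
  -- column sums
  have hcol : ∀ x, δ * n / 3 ≤ ∑ t, m t * (if x ∈ s t then (1 : ℝ) else 0) := by
    intro x
    obtain ⟨Y, hYc, hY⟩ := hspecial x
    have hsum : ∀ y ∈ Y, (1 / 3 : ℝ) ≤
        ∑ t : R, if t.1.1 = x ∧ t.1.2.1 = y then m t else 0 := by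
      intro y hy
      obtain ⟨z, hz⟩ := hY y hy
      have hxy : x ≠ y := hz.1
      have hmem : ∀ w, w ∈ ((line x y).erase x).erase y → CollinearTriple v (x, y, w) := by
        intro w hw
        simp only [Finset.mem_erase] at hw
        exact ⟨hxy, hw.2.1, hw.1, (Finset.mem_filter.1 hw.2.2).2⟩
      have hxl : x ∈ line x y := Finset.mem_filter.2 ⟨Finset.mem_univ _,
        Submodule.subset_span (by simp)⟩
      have hyl : y ∈ (line x y).erase x := Finset.mem_erase.2 ⟨hxy.symm,
        Finset.mem_filter.2 ⟨Finset.mem_univ _, Submodule.subset_span (by simp)⟩⟩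
      have hzl : z ∈ ((line x y).erase x).erase y := by
        simp only [Finset.mem_erase]
        exact ⟨hz.2.2.1, hz.2.1, Finset.mem_filter.2 ⟨Finset.mem_univ _, hz.2.2.2⟩⟩
      have hc1 := Finset.card_erase_add_one hxl
      have hc2 := Finset.card_erase_add_one hyl
      have hc3 := Finset.card_pos.2 ⟨z, hzl⟩
      set k := (((line x y).erase x).erase y).card with hk
      have hlc : (line x y).card = k + 2 := by omega
      have hk1 : (1 : ℝ) ≤ k := by exact_mod_cast hc3
      calc (1 / 3 : ℝ) ≤ k * ((k : ℝ) + 2)⁻¹ := by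
            rw [← div_eq_mul_inv, div_le_div_iff₀ (by norm_num) (by positivity)]; linarith
        _ = ∑ w ∈ (((line x y).erase x).erase y).attach, ((k : ℝ) + 2)⁻¹ := by
            rw [Finset.sum_const, Finset.card_attach, nsmul_eq_mul]
        _ = ∑ t ∈ ((((line x y).erase x).erase y).attach.image
              fun w => (⟨(x, y, w.1), hmem w.1 w.2⟩ : R)), ((k : ℝ) + 2)⁻¹ := by
            rw [Finset.sum_image]
            intro w _ w' _ h
            have := congrArg (fun t : R => t.1.2.2) h
            exact Subtype.ext this
        _ ≤ _ := by
            rw [← Finset.sum_filter]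
            calc _ = ∑ t ∈ ((((line x y).erase x).erase y).attach.image
                    fun w => (⟨(x, y, w.1), hmem w.1 w.2⟩ : R)), m t := by
                  refine Finset.sum_congr rfl fun t ht => ?_
                  obtain ⟨w, -, rfl⟩ := Finset.mem_image.1 ht
                  simp only [hm]
                  rw [hlc]; push_cast; rfl
              _ ≤ _ := by
                  refine Finset.sum_le_sum_of_subset_of_nonneg ?_ fun t _ _ => hm0 t
                  intro t ht
                  obtain ⟨w, -, rfl⟩ := Finset.mem_image.1 ht
                  simp
    calc δ * n / 3 ≤ Y.card * (1 / 3 : ℝ) := by linarith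
      _ = ∑ y ∈ Y, (1 / 3 : ℝ) := by rw [Finset.sum_const, nsmul_eq_mul]
      _ ≤ ∑ y ∈ Y, ∑ t : R, (if t.1.1 = x ∧ t.1.2.1 = y then m t else 0) :=
          Finset.sum_le_sum hsum
      _ = ∑ t : R, ∑ y ∈ Y, (if t.1.1 = x ∧ t.1.2.1 = y then m t else 0) := Finset.sum_comm
      _ ≤ _ := by
          refine Finset.sum_le_sum fun t _ => ?_
          by_cases h : t.1.1 = x
          · have hx : x ∈ s t := by simp [hs, h]
            simp only [h, true_and, hx, if_true, mul_one, Finset.sum_ite_eq]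
            split_ifs
            · exact le_rfl
            · exact hm0 t
          · simp only [h, false_and, if_false, Finset.sum_const_zero]
            split_ifs <;> simp [hm0 t]
  -- scaling
  set b : R → X → ℝ := fun t x => ‖a t x‖ ^ 2 with hb
  have hbpos : ∀ t x, x ∈ s t → 0 < b t x := fun t x hx => by
    have := (ha t x).2 hx
    positivity
  have hbzero : ∀ t x, x ∉ s t → b t x = 0 := fun t x hx => by
    have : a t x = 0 := by
      by_contra h
      exact hx ((ha t x).1 h)
    simp [hb, this]
  obtain ⟨u, hu⟩ := exists_approx_scaling b m hm0 s hbpos hbzero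
    (fun t => ⟨t.1.1, by simp [hs]⟩) (show 0 < δ * n / 6 by positivity)
  set S : R → ℝ := fun t => ∑ y, b t y * Real.exp (u y) with hS
  have hb0 : ∀ t x, 0 ≤ b t x := fun t x => by positivity
  have hS0 : ∀ t, 0 < S t := fun t =>
    Finset.sum_pos' (fun y _ => mul_nonneg (hb0 t y) (Real.exp_pos _).le)
      ⟨t.1.1, Finset.mem_univ _, mul_pos (hbpos t _ (by simp [hs])) (Real.exp_pos _)⟩
  set A : Matrix R X ℂ := fun t x =>
    ((Real.sqrt (3 * m t / S t) : ℝ) : ℂ) * a t x * ((Real.exp (u x / 2) : ℝ) : ℂ) with hA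
  have hexp : ∀ x, Real.exp (u x / 2) ^ 2 = Real.exp (u x) := fun x => by
    rw [← Real.exp_nat_mul]; congr 1; push_cast; ring
  have hAn : ∀ t x, ‖A t x‖ ^ 2 = m t * (3 * ((b t x * Real.exp (u x)) / S t)) := by
    intro t x
    have h3 : 0 ≤ 3 * m t / S t := div_nonneg (mul_nonneg (by norm_num) (hm0 t)) (hS0 t).le
    simp only [hA]
    rw [norm_mul, norm_mul, Complex.norm_real, Complex.norm_real, mul_pow, mul_pow,
      Real.norm_eq_abs, Real.norm_eq_abs, sq_abs, sq_abs, Real.sq_sqrt h3, hexp]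
    simp only [hb]; ring
  have hAz : ∀ t x, x ∉ s t → ‖A t x‖ = 0 := by
    intro t x hx
    have h := hAn t x
    rw [hbzero t x hx] at h
    simpa using h
  have hdiag : ∀ x, δ * n / 6 ≤ ∑ t, ‖A t x‖ ^ 2 := by
    intro x
    have h1 := (abs_le.1 (hu x)).1
    have h2 := hcol x
    simp only [hAn]
    have h3 : (∑ t, m t * (((s t).card : ℝ) * ((b t x * Real.exp (u x)) / S t))) =
        ∑ t, m t * (3 * ((b t x * Real.exp (u x)) / S t)) := by
      refine Finset.sum_congr rfl fun t _ => ?_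
      rw [hscard t]; norm_num
    rw [← h3]
    linarith
  have hoff : ∀ x y, (if x = y then 0 else ∑ t, ‖A t x‖ * ‖A t y‖) ≤ 9 := by
    intro x y
    split_ifs with hxy
    · norm_num
    have hle : ∀ t, ‖A t x‖ * ‖A t y‖ ≤ (3 / 2) * (m t * (if x ∈ s t ∧ y ∈ s t then 1 else 0)) := by
      intro t
      split_ifs with h
      · have h1 := hAn t x
        have h2 := hAn t y
        have h3 : b t x * Real.exp (u x) / S t + b t y * Real.exp (u y) / S t ≤ 1 := by
          rw [← add_div, div_le_one (hS0 t)]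
          have := Finset.sum_le_sum_of_subset_of_nonneg (Finset.subset_univ ({x, y} : Finset X))
            (f := fun y => b t y * Real.exp (u y))
            (fun w _ _ => mul_nonneg (hb0 t w) (Real.exp_pos _).le)
          rw [Finset.sum_pair hxy] at this
          exact this
        have h4 := two_mul_le_add_sq ‖A t x‖ ‖A t y‖
        have h5 := mul_le_mul_of_nonneg_left h3 (hm0 t)
        nlinarith
      · by_cases hx : x ∈ s t
        · rw [hAz t y fun hy => h ⟨hx, hy⟩]; simp
        · rw [hAz t x hx]; simp
    calc _ ≤ ∑ t, (3 / 2) * (m t * (if x ∈ s t ∧ y ∈ s t then 1 else 0)) :=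
          Finset.sum_le_sum fun t _ => hle t
      _ ≤ 9 := by rw [← Finset.mul_sum]; have := hpair x y hxy; linarith
  set E' := Submodule.span ℂ (Set.range v) with hE'
  have hvE : ∀ x, v x ∈ E' := fun x => Submodule.subset_span ⟨x, rfl⟩
  have : FiniteDimensional ℂ E' := FiniteDimensional.span_of_finite ℂ (Set.finite_range v)
  let ev : Module.Dual ℂ E' →ₗ[ℂ] (X → ℂ) :=
    { toFun := fun φ x => ((Real.exp (-(u x / 2)) : ℝ) : ℂ) * φ ⟨v x, hvE x⟩
      map_add' := fun φ ψ => by ext x; simp [mul_add]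
      map_smul' := fun c φ => by ext x; simp; ring }
  have hinj : Function.Injective ev := by
    rw [← LinearMap.ker_eq_bot, LinearMap.ker_eq_bot']
    intro φ hφ
    have h1 : ∀ x, φ ⟨v x, hvE x⟩ = 0 := by
      intro x
      have := congrFun hφ x
      have h2 : ((Real.exp (-(u x / 2)) : ℝ) : ℂ) * φ ⟨v x, hvE x⟩ = 0 := this
      rcases mul_eq_zero.1 h2 with h | h
      · exact absurd (Complex.ofReal_eq_zero.1 h) (Real.exp_pos _).ne'
      · exact h
    ext ⟨w, hw⟩
    induction hw using Submodule.span_induction with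
    | mem w hw => obtain ⟨x, rfl⟩ := hw; exact h1 x
    | zero => exact map_zero φ
    | add p q hp hq h1 h2 =>
      have : (⟨p + q, E'.add_mem hp hq⟩ : E') = ⟨p, hp⟩ + ⟨q, hq⟩ := rfl
      rw [this, map_add, h1, h2]; simp
    | smul c p hp h1 =>
      have : (⟨c • p, E'.smul_mem c hp⟩ : E') = c • ⟨p, hp⟩ := rfl
      rw [this, map_smul, h1]; simp
  have hker : ∀ w ∈ LinearMap.range ev, A.mulVec w = 0 := by
    rintro _ ⟨φ, rfl⟩
    ext t
    have h1 : ∑ x, a t x • (⟨v x, hvE x⟩ : E') = 0 := by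
      apply Subtype.ext
      rw [Submodule.coe_sum]
      exact hrel t
    have h2 := congrArg φ h1
    rw [map_sum, map_zero] at h2
    show ∑ x, A t x * (((Real.exp (-(u x / 2)) : ℝ) : ℂ) * φ ⟨v x, hvE x⟩) = 0
    have h3 : ∀ x, A t x * (((Real.exp (-(u x / 2)) : ℝ) : ℂ) * φ ⟨v x, hvE x⟩) =
        ((Real.sqrt (3 * m t / S t) : ℝ) : ℂ) * φ (a t x • ⟨v x, hvE x⟩) := by
      intro x
      have h4 : ((Real.exp (u x / 2) : ℝ) : ℂ) * ((Real.exp (-(u x / 2)) : ℝ) : ℂ) = 1 := by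
        rw [← Complex.ofReal_mul, ← Real.exp_add]; simp
      rw [map_smul, smul_eq_mul]
      simp only [hA]
      linear_combination ((Real.sqrt (3 * m t / S t) : ℝ) : ℂ) * a t x * φ ⟨v x, hvE x⟩ * h4
    rw [Finset.sum_congr rfl fun x _ => h3 x, ← Finset.mul_sum, h2, mul_zero]
  have hfin := finrank_mul_sq_le_of_mulVec_eq_zero A (LinearMap.range ev) hker
    (show 0 < δ * n / 6 by positivity) hdiag (T := n * (n * 81)) (by
      calc _ ≤ ∑ x : X, ∑ y : X, (81 : ℝ) := by
            refine Finset.sum_le_sum fun x _ => Finset.sum_le_sum fun y _ => ?_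
            have h0 : 0 ≤ (if x = y then 0 else ∑ t, ‖A t x‖ * ‖A t y‖) := by
              split_ifs
              · exact le_rfl
              · exact Finset.sum_nonneg fun t _ => by positivity
            calc _ ≤ (9 : ℝ) ^ 2 := pow_le_pow_left₀ h0 (hoff x y) 2
              _ = 81 := by norm_num
        _ = _ := by simp [hn])
  rw [LinearMap.finrank_range_of_inj hinj, Subspace.dual_finrank_eq] at hfin
  have hn2 : 0 < n ^ 2 := by positivity
  have : (Module.finrank ℂ E' * δ ^ 2) * n ^ 2 ≤ 2916 * n ^ 2 := by nlinarith
  exact le_of_mul_le_mul_right this hn2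

/-- The space of linear forms. -/
noncomputable abbrev linForms (n : ℕ) : Submodule ℂ (MvPolynomial (Fin n) ℂ) :=
  homogeneousSubmodule (Fin n) ℂ 1

theorem linForms_eq_span (n : ℕ) :
    linForms n = Submodule.span ℂ (Set.range (X : Fin n → MvPolynomial (Fin n) ℂ)) :=
  homogeneousSubmodule_one_eq_span_X ..

theorem MvPolynomial.IsHomogeneous.mem_linForms_mul {n : ℕ} {F : MvPolynomial (Fin n) ℂ}
    (hF : F.IsHomogeneous 2) : F ∈ linForms n * linForms n := by
  rw [← pow_two, homogeneousSubmodule_one_pow]; exact hF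

theorem isHomogeneous_of_mem_linForms_mul {n : ℕ} {F : MvPolynomial (Fin n) ℂ}
    (hF : F ∈ linForms n * linForms n) : F.IsHomogeneous 2 := by
  rw [← pow_two, homogeneousSubmodule_one_pow] at hF; exact hF

section Points

variable {n : ℕ} {K : Type*} [Field K] [Algebra ℂ K]

/-- The point with coordinates prescribed by the values of `g` on the variables. -/
noncomputable def pointOf (g : MvPolynomial (Fin n) ℂ →ₗ[ℂ] K) :
    MvPolynomial (Fin n) ℂ →ₐ[ℂ] K :=
  aeval fun i => g (X i)

theorem pointOf_apply_of_mem (g : MvPolynomial (Fin n) ℂ →ₗ[ℂ] K) {l : MvPolynomial (Fin n) ℂ}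
    (hl : l ∈ linForms n) : pointOf g l = g l := by
  rw [linForms_eq_span] at hl
  induction hl using Submodule.span_induction with
  | mem x hx => obtain ⟨i, rfl⟩ := hx; simp [pointOf]
  | zero => simp
  | add x y _ _ hx hy => rw [map_add, map_add, hx, hy]
  | smul a x _ hx => rw [map_smul, map_smul, hx]

theorem algHom_eq_of_mem_mul {A B : Type*} [CommSemiring A] [Algebra ℂ A] [CommSemiring B]
    [Algebra ℂ B] {φ ψ : A →ₐ[ℂ] B}
    {V : Submodule ℂ A} (h : ∀ l ∈ V, φ l = ψ l) {F : A} (hF : F ∈ V * V) : φ F = ψ F := by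
  induction hF using Submodule.mul_induction_on' with
  | mem_mul_mem a ha b hb => rw [map_mul, map_mul, h a ha, h b hb]
  | add x _ y _ hx hy => rw [map_add, map_add, hx, hy]

theorem pointOf_eq_of_mem_mul (g : MvPolynomial (Fin n) ℂ →ₗ[ℂ] K)
    (φ : MvPolynomial (Fin n) ℂ →ₐ[ℂ] K) {V : Submodule ℂ (MvPolynomial (Fin n) ℂ)}
    (hV : V ≤ linForms n) (h : ∀ l ∈ V, g l = φ l) {F : MvPolynomial (Fin n) ℂ}
    (hF : F ∈ V * V) : pointOf g F = φ F :=
  algHom_eq_of_mem_mul (fun l hl => by rw [pointOf_apply_of_mem g (hV hl), h l hl]) hF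

/-- Restricted to a line of points, a quadratic form is a polynomial of degree at most two. -/
theorem exists_polynomial_along_line (g g' : MvPolynomial (Fin n) ℂ →ₗ[ℂ] K)
    {F : MvPolynomial (Fin n) ℂ} (hF : F ∈ linForms n * linForms n) :
    ∃ q : Polynomial K, q.natDegree ≤ 2 ∧
      ∀ t : K, q.eval t = pointOf (g + t • (g' - g)) F := by
  induction hF using Submodule.mul_induction_on' with
  | mem_mul_mem a ha b hb =>
    refine ⟨(Polynomial.C (g a) + Polynomial.C ((g' - g) a) * Polynomial.X) *
      (Polynomial.C (g b) + Polynomial.C ((g' - g) b) * Polynomial.X), ?_, fun t => ?_⟩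
    · compute_degree
    · rw [map_mul, pointOf_apply_of_mem _ ha, pointOf_apply_of_mem _ hb]
      simp; ring
  | add x _ y _ hx hy =>
    obtain ⟨q, hq, hq'⟩ := hx
    obtain ⟨r, hr, hr'⟩ := hy
    refine ⟨q + r, Polynomial.natDegree_add_le_of_degree_le hq hr, fun t => ?_⟩
    rw [Polynomial.eval_add, hq', hr', map_add]

/-- A function on points whose restriction to every line is a polynomial function. -/
def PolynomialOnLines (G : (MvPolynomial (Fin n) ℂ →ₗ[ℂ] K) → K) : Prop :=
  ∀ g g', ∃ q : Polynomial K, ∀ t : K, q.eval t = G (g + t • (g' - g))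

theorem polynomialOnLines_pointOf {F : MvPolynomial (Fin n) ℂ}
    (hF : F ∈ linForms n * linForms n) :
    PolynomialOnLines fun g : MvPolynomial (Fin n) ℂ →ₗ[ℂ] K => pointOf g F := fun g g' =>
  let ⟨q, _, hq⟩ := exists_polynomial_along_line g g' hF
  ⟨q, hq⟩

/-- A set of points closed under taking lines. -/
def LineClosed (A : Set (MvPolynomial (Fin n) ℂ →ₗ[ℂ] K)) : Prop :=
  ∀ g ∈ A, ∀ g' ∈ A, ∀ t : K, g + t • (g' - g) ∈ A

theorem LineClosed.exists_ne_zero {A : Set (MvPolynomial (Fin n) ℂ →ₗ[ℂ] K)} (hA : LineClosed A)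
    (hne : A.Nonempty) {ι : Type*} (s : Finset ι) (G : ι → (MvPolynomial (Fin n) ℂ →ₗ[ℂ] K) → K)
    (hG : ∀ i ∈ s, PolynomialOnLines (G i)) (h : ∀ i ∈ s, ∃ g ∈ A, G i g ≠ 0) :
    ∃ g ∈ A, ∀ i ∈ s, G i g ≠ 0 := by
  classical
  have : Infinite K := Infinite.of_injective _ (algebraMap ℂ K).injective
  induction s using Finset.induction_on with
  | empty => obtain ⟨g, hg⟩ := hne; exact ⟨g, hg, by simp⟩
  | insert k s hk ih =>
    obtain ⟨g, hg, hgs⟩ := ih (fun i hi => hG i (Finset.mem_insert_of_mem hi))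
      (fun i hi => h i (Finset.mem_insert_of_mem hi))
    obtain ⟨g', hg', hgk⟩ := h k (Finset.mem_insert_self _ _)
    choose! q hq using fun i (hi : i ∈ insert k s) => hG i hi g g'
    have hprod : ∏ i ∈ insert k s, q i ≠ 0 := by
      refine Finset.prod_ne_zero_iff.2 fun i hi h0 => ?_
      rcases Finset.mem_insert.1 hi with rfl | his
      · have := hq i hi 1
        rw [h0] at this
        simp at this
        exact hgk this.symm
      · have := hq i hi 0
        rw [h0] at this
        simp at this
        exact hgs i his this.symm
    obtain ⟨t, ht⟩ := Polynomial.exists_eval_ne_zero_of_natDegree_lt_card _ hprod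
      (Cardinal.natCast_lt_aleph0.trans_le (Cardinal.infinite_iff.1 this))
    refine ⟨_, hA g hg g' hg' t, fun i hi => ?_⟩
    rw [← hq i hi t]
    rw [Polynomial.eval_prod] at ht
    exact Finset.prod_ne_zero_iff.1 ht i hi

theorem LineClosed.exists_forall_eq_zero {A : Set (MvPolynomial (Fin n) ℂ →ₗ[ℂ] K)}
    (hA : LineClosed A) (hne : A.Nonempty) {ι : Type*} (s : Finset ι)
    (F : ι → MvPolynomial (Fin n) ℂ) (hF : ∀ i, F i ∈ linForms n * linForms n)
    (h : ∀ g ∈ A, ∃ i ∈ s, pointOf g (F i) = 0) :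
    ∃ i ∈ s, ∀ g ∈ A, pointOf g (F i) = 0 := by
  by_contra! hcon
  obtain ⟨g, hg, hgs⟩ := hA.exists_ne_zero hne s (fun i g => pointOf g (F i))
    (fun i _ => polynomialOnLines_pointOf (hF i)) hcon
  obtain ⟨i, hi, h0⟩ := h g hg
  exact hgs i hi h0

/-- The points whose values on `W` agree with those of `g₀`. -/
def agreeOn (W : Submodule ℂ (MvPolynomial (Fin n) ℂ)) (g₀ : MvPolynomial (Fin n) ℂ →ₗ[ℂ] K) :
    Set (MvPolynomial (Fin n) ℂ →ₗ[ℂ] K) :=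
  {g | ∀ l ∈ W, g l = g₀ l}

theorem lineClosed_agreeOn (W : Submodule ℂ (MvPolynomial (Fin n) ℂ))
    (g₀ : MvPolynomial (Fin n) ℂ →ₗ[ℂ] K) : LineClosed (agreeOn W g₀) := by
  intro g hg g' hg' t l hl
  simp [hg l hl, hg' l hl]

theorem self_mem_agreeOn (W : Submodule ℂ (MvPolynomial (Fin n) ℂ))
    (g₀ : MvPolynomial (Fin n) ℂ →ₗ[ℂ] K) : g₀ ∈ agreeOn W g₀ := fun _ _ => rfl

theorem exists_functional {E : Type*} [AddCommGroup E] [Module ℂ E] (W : Submodule ℂ E) {c : E}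
    (hc : c ∉ W) : ∃ f : E →ₗ[ℂ] ℂ, (∀ l ∈ W, f l = 0) ∧ f c = 1 := by
  obtain ⟨f, hf, hW⟩ := Submodule.exists_le_ker_of_notMem hc
  refine ⟨(f c)⁻¹ • f, fun l hl => ?_, ?_⟩
  · have : f l = 0 := hW hl
    simp [this]
  · simp [hf]

/-- Changing the value of a point at `c` without changing it on the kernel of `f`. -/
noncomputable def shift (g : MvPolynomial (Fin n) ℂ →ₗ[ℂ] K)
    (f : MvPolynomial (Fin n) ℂ →ₗ[ℂ] ℂ) (k : K) : MvPolynomial (Fin n) ℂ →ₗ[ℂ] K :=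
  g + f.smulRight k

@[simp]
theorem shift_apply (g : MvPolynomial (Fin n) ℂ →ₗ[ℂ] K)
    (f : MvPolynomial (Fin n) ℂ →ₗ[ℂ] ℂ) (k : K) (l : MvPolynomial (Fin n) ℂ) :
    shift g f k l = g l + f l • k := rfl

/-- Values can be prescribed on a subspace and at one vector outside it. -/
theorem exists_agreeOn_apply_eq (W : Submodule ℂ (MvPolynomial (Fin n) ℂ))
    (g₀ : MvPolynomial (Fin n) ℂ →ₗ[ℂ] K) {c : MvPolynomial (Fin n) ℂ} (hc : c ∉ W) (τ : K) :
    ∃ g ∈ agreeOn W g₀, g c = τ := by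
  obtain ⟨f, hf, hfc⟩ := exists_functional W hc
  refine ⟨shift g₀ f (τ - g₀ c), fun l hl => ?_, ?_⟩
  · simp [hf l hl]
  · simp [hfc]

theorem exists_decomposition {A : Type*} [CommRing A] [Algebra ℂ A] (V : Submodule ℂ A) (c : A)
    {F : A} (hF : F ∈ (V ⊔ Submodule.span ℂ {c}) * (V ⊔ Submodule.span ℂ {c})) :
    ∃ (e : ℂ) (l g : A), l ∈ V ∧ g ∈ V * V ∧ F = e • c ^ 2 + l * c + g := by
  induction hF using Submodule.mul_induction_on' with
  | mem_mul_mem a ha b hb =>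
    obtain ⟨a, haV, x, hx, rfl⟩ := Submodule.mem_sup.1 ha
    obtain ⟨b, hbV, y, hy, rfl⟩ := Submodule.mem_sup.1 hb
    obtain ⟨α, rfl⟩ := Submodule.mem_span_singleton.1 hx
    obtain ⟨β, rfl⟩ := Submodule.mem_span_singleton.1 hy
    refine ⟨α * β, β • a + α • b, a * b, V.add_mem (V.smul_mem _ haV) (V.smul_mem _ hbV),
      Submodule.mul_mem_mul haV hbV, ?_⟩
    simp only [Algebra.smul_def, map_mul]; ring
  | add x _ y _ hx hy =>
    obtain ⟨e, l, g, hl, hg, rfl⟩ := hx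
    obtain ⟨e', l', g', hl', hg', rfl⟩ := hy
    refine ⟨e + e', l + l', g + g', V.add_mem hl hl', Submodule.add_mem _ hg hg', ?_⟩
    rw [add_smul]; ring

/-- A quadratic form in `V` and `c'` vanishing at all points extending the values of `φ` on `V`,
with the value at `c'` free, vanishes at `φ`. -/
theorem eq_zero_of_forall_agreeOn {V W : Submodule ℂ (MvPolynomial (Fin n) ℂ)}
    (hVL : V ≤ linForms n) (hVW : V ≤ W) (φ : MvPolynomial (Fin n) ℂ →ₐ[ℂ] K)
    (g₀ : MvPolynomial (Fin n) ℂ →ₗ[ℂ] K) (hg₀ : ∀ l ∈ V, g₀ l = φ l)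
    {c : MvPolynomial (Fin n) ℂ} (hcL : c ∈ linForms n) (hc : c ∉ W) {F : MvPolynomial (Fin n) ℂ}
    (hF : F ∈ (V ⊔ Submodule.span ℂ {c}) * (V ⊔ Submodule.span ℂ {c}))
    (h : ∀ g ∈ agreeOn W g₀, pointOf g F = 0) : φ F = 0 := by
  obtain ⟨e, l, q, hl, hq, rfl⟩ := exists_decomposition V c hF
  obtain ⟨g, hg, hgc⟩ := exists_agreeOn_apply_eq W g₀ hc (φ c)
  rw [← h g hg]
  have h1 : ∀ l ∈ V, g l = φ l := fun l hl => (hg l (hVW hl)).trans (hg₀ l hl)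
  simp only [map_add, map_smul, map_mul, map_pow, pointOf_apply_of_mem g hcL,
    pointOf_apply_of_mem g (hVL hl), h1 l hl, hgc, pointOf_eq_of_mem_mul g φ hVL h1 hq]

end Points

theorem exists_smul_eq_of_dvd {n k : ℕ} {p F : MvPolynomial (Fin n) ℂ} (hp0 : p ≠ 0)
    (hp : p.IsHomogeneous k) (hF : F.IsHomogeneous k) (h : p ∣ F) : ∃ γ : ℂ, F = γ • p := by
  obtain ⟨q, rfl⟩ := h
  by_cases hq : q = 0
  · exact ⟨0, by simp [hq]⟩
  have h1 := totalDegree_mul_of_isDomain hp0 hq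
  rw [hF.totalDegree (mul_ne_zero hp0 hq), hp.totalDegree hp0] at h1
  have h2 : q.totalDegree = 0 := by omega
  rw [totalDegree_eq_zero_iff_eq_C] at h2
  refine ⟨coeff 0 q, ?_⟩
  rw [smul_eq_C_mul, ← h2, mul_comm]

theorem degree_le_of_dvd {n k m : ℕ} {p F : MvPolynomial (Fin n) ℂ} (hF0 : F ≠ 0)
    (hp : p.IsHomogeneous k) (hF : F.IsHomogeneous m) (h : p ∣ F) : k ≤ m := by
  obtain ⟨q, rfl⟩ := h
  have hp0 : p ≠ 0 := left_ne_zero_of_mul hF0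
  have hq : q ≠ 0 := right_ne_zero_of_mul hF0
  have h1 := totalDegree_mul_of_isDomain hp0 hq
  rw [hF.totalDegree hF0, hp.totalDegree hp0] at h1
  omega

section Projection

variable {n : ℕ} {K : Type*} [Field K] [Algebra ℂ K]
  (f : MvPolynomial (Fin n) ℂ →ₗ[ℂ] ℂ) (c : MvPolynomial (Fin n) ℂ)

/-- The substitution multiplying `c` by `1 - s` and fixing the linear forms in the kernel of `f`,
when `f c = 1`. -/
noncomputable def scaleAlong (s : ℂ) : MvPolynomial (Fin n) ℂ →ₐ[ℂ] MvPolynomial (Fin n) ℂ :=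
  aeval fun i => X i - (s * f (X i)) • c

theorem scaleAlong_apply (s : ℂ) {l : MvPolynomial (Fin n) ℂ} (hl : l ∈ linForms n) :
    scaleAlong f c s l = l - (s * f l) • c := by
  rw [linForms_eq_span] at hl
  induction hl using Submodule.span_induction with
  | mem x hx => obtain ⟨i, rfl⟩ := hx; simp [scaleAlong]
  | zero => simp
  | add x y _ _ hx hy => rw [map_add, map_add, hx, hy, mul_add, add_smul]; abel
  | smul a x _ hx => rw [map_smul, map_smul, hx, smul_sub, smul_smul, smul_eq_mul]; congr 2; ring

variable {f c}

theorem scaleAlong_one_mem {l : MvPolynomial (Fin n) ℂ} (hc : c ∈ linForms n)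
    (hl : l ∈ linForms n) : scaleAlong f c 1 l ∈ linForms n := by
  rw [scaleAlong_apply f c 1 hl]
  exact Submodule.sub_mem _ hl (Submodule.smul_mem _ _ hc)

theorem scaleAlong_scaleAlong_one (s : ℂ) (hc : c ∈ linForms n) (hfc : f c = 1)
    (F : MvPolynomial (Fin n) ℂ) :
    scaleAlong f c s (scaleAlong f c 1 F) = scaleAlong f c 1 F := by
  have : (scaleAlong f c s).comp (scaleAlong f c 1) = scaleAlong f c 1 := by
    refine MvPolynomial.algHom_ext fun i => ?_
    have hX : (X i : MvPolynomial (Fin n) ℂ) ∈ linForms n := isHomogeneous_X ℂ i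
    rw [AlgHom.comp_apply, scaleAlong_apply f c s (scaleAlong_one_mem hc hX),
      scaleAlong_apply f c 1 hX, map_sub, map_smul, hfc]
    simp
  exact DFunLike.congr_fun this F

theorem scaleAlong_of_fixed (s : ℂ) (hc : c ∈ linForms n) (hfc : f c = 1)
    {F : MvPolynomial (Fin n) ℂ} (hF : scaleAlong f c 1 F = F) : scaleAlong f c s F = F := by
  rw [← hF, scaleAlong_scaleAlong_one s hc hfc]

theorem pointOf_shift_of_fixed (hc : c ∈ linForms n) (hfc : f c = 1)
    (φ : MvPolynomial (Fin n) ℂ →ₐ[ℂ] K) (k : K) {F : MvPolynomial (Fin n) ℂ}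
    (hF : scaleAlong f c 1 F = F) : pointOf (shift φ.toLinearMap f k) F = φ F := by
  have : (pointOf (shift φ.toLinearMap f k)).comp (scaleAlong f c 1) =
      φ.comp (scaleAlong f c 1) := by
    refine MvPolynomial.algHom_ext fun i => ?_
    have hX : (X i : MvPolynomial (Fin n) ℂ) ∈ linForms n := isHomogeneous_X ℂ i
    rw [AlgHom.comp_apply, AlgHom.comp_apply, pointOf_apply_of_mem _ (scaleAlong_one_mem hc hX),
      shift_apply, scaleAlong_apply f c 1 hX, map_sub f, map_smul f, hfc]
    simp
  rw [← hF]
  exact DFunLike.congr_fun this F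

theorem exists_fixed_decomposition (hc : c ∈ linForms n) (hfc : f c = 1)
    {F : MvPolynomial (Fin n) ℂ} (hF : F ∈ linForms n * linForms n) :
    ∃ (e : ℂ) (l g : MvPolynomial (Fin n) ℂ), l.IsHomogeneous 1 ∧ g.IsHomogeneous 2 ∧
      scaleAlong f c 1 l = l ∧ scaleAlong f c 1 g = g ∧ F = C e * c ^ 2 + l * c + g := by
  set H : Submodule ℂ (MvPolynomial (Fin n) ℂ) :=
    (linForms n).map (scaleAlong f c 1).toLinearMap with hH
  have hHL : H ≤ linForms n := by
    rintro _ ⟨l, hl, rfl⟩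
    exact scaleAlong_one_mem hc hl
  have hLH : linForms n ≤ H ⊔ Submodule.span ℂ {c} := by
    intro l hl
    refine Submodule.mem_sup.2 ⟨scaleAlong f c 1 l, ⟨l, hl, rfl⟩, f l • c,
      Submodule.smul_mem _ _ (Submodule.mem_span_singleton_self c), ?_⟩
    rw [scaleAlong_apply f c 1 hl]; simp
  have hfix : ∀ l ∈ H, scaleAlong f c 1 l = AlgHom.id ℂ _ l := by
    rintro _ ⟨l, hl, rfl⟩
    exact scaleAlong_scaleAlong_one 1 hc hfc l
  obtain ⟨e, l, g, hl, hg, rfl⟩ := exists_decomposition H c (mul_le_mul' hLH hLH hF)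
  exact ⟨e, l, g, hHL hl, isHomogeneous_of_mem_linForms_mul (mul_le_mul' hHL hHL hg),
    hfix l hl, algHom_eq_of_mem_mul hfix hg, by rw [smul_eq_C_mul]⟩

theorem scaleAlong_self (s : ℂ) (hc : c ∈ linForms n) (hfc : f c = 1) :
    scaleAlong f c s c = (1 - s) • c := by
  rw [scaleAlong_apply f c s hc, hfc, sub_smul]; simp

theorem decomposition_eq_zero (hc : c ∈ linForms n) (hfc : f c = 1) {e : ℂ}
    {l g : MvPolynomial (Fin n) ℂ} (hl : scaleAlong f c 1 l = l) (hg : scaleAlong f c 1 g = g)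
    (h : C e * c ^ 2 + l * c + g = 0) : e = 0 ∧ l = 0 ∧ g = 0 := by
  have hc0 : c ≠ 0 := by rintro rfl; simp at hfc
  have h1 := congrArg (scaleAlong f c 1) h
  have h2 := congrArg (scaleAlong f c 2) h
  have hC : ∀ s, scaleAlong f c s (C e) = C e := fun s => by
    rw [← algebraMap_eq, AlgHom.commutes]
  simp only [map_add, map_mul, map_pow, map_zero, scaleAlong_of_fixed _ hc hfc hl,
    scaleAlong_of_fixed _ hc hfc hg, scaleAlong_self _ hc hfc, hC] at h1 h2
  norm_num at h1 h2
  have h3 : (2 : MvPolynomial (Fin n) ℂ) * (l * c) = 0 := by linear_combination h - h2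
  have h4 : l * c = 0 := by simpa using h3
  have hl0 : l = 0 := by simpa [hc0] using h4
  have h5 : C e * c ^ 2 = 0 := by linear_combination h - h4 - h1
  refine ⟨?_, hl0, h1⟩
  simpa [hc0] using h5

/-- Eliminating `c` between a quadratic form and a prime form involving `c`. -/
theorem exists_eliminant (hc : c ∈ linForms n) (hfc : f c = 1) {F p : MvPolynomial (Fin n) ℂ}
    (hF : F ∈ linForms n * linForms n) (hp : Prime p)
    (hpd : p ∈ linForms n ∨ p ∈ linForms n * linForms n) (hndvd : ¬ p ∣ F)
    (hσ : scaleAlong f c 1 p ≠ p) :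
    ∃ R : MvPolynomial (Fin n) ℂ, R ≠ 0 ∧ scaleAlong f c 1 R = R ∧ R.totalDegree ≤ 4 ∧
      ∃ u w, R = u * F + w * p := by
  have hC : ∀ e, scaleAlong f c 1 (C e) = C e := fun e => by
    rw [← algebraMap_eq, AlgHom.commutes]
  have hunit : ∀ {e : ℂ} {G : MvPolynomial (Fin n) ℂ}, e ≠ 0 → p ∣ C e * G → p ∣ G := by
    intro e G he h
    have : G = C e⁻¹ * (C e * G) := by
      rw [← mul_assoc, ← C_mul, inv_mul_cancel₀ he, C_1, one_mul]
    rw [this]; exact h.mul_left _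
  obtain ⟨e, l, g, hl, hg, hlσ, hgσ, hFe⟩ := exists_fixed_decomposition hc hfc hF
  rcases hpd with hpL | hpQ
  · set h := scaleAlong f c 1 p with hh
    have hhL : h.IsHomogeneous 1 := scaleAlong_one_mem hc hpL
    have hhσ : scaleAlong f c 1 h = h := scaleAlong_scaleAlong_one 1 hc hfc p
    set α := f p with hα
    have hph : p = C α * c + h := by
      rw [hh, scaleAlong_apply f c 1 hpL, smul_eq_C_mul]; simp [hα]
    have hα0 : α ≠ 0 := by
      intro h0
      apply hσ
      rw [hph, h0]; simp
    have key : C e * h ^ 2 - C α * l * h + C (α ^ 2) * g =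
        C (α ^ 2) * F + (-(C e * (p - 2 * h) + C α * l)) * p := by
      rw [hFe, hph, C_pow]; ring
    refine ⟨C e * h ^ 2 - C α * l * h + C (α ^ 2) * g, fun h0 => hndvd ?_, ?_, ?_, _, _, key⟩
    · refine hunit (pow_ne_zero 2 hα0) ?_
      rw [h0] at key
      exact ⟨C e * (p - 2 * h) + C α * l, by linear_combination -key⟩
    · simp only [map_add, map_sub, map_mul, map_pow, hC, hlσ, hgσ, hhσ]
    · refine le_trans (IsHomogeneous.totalDegree_le (n := 2) ?_) (by norm_num)
      refine IsHomogeneous.add (IsHomogeneous.sub ?_ ?_) ?_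
      · exact (hhL.pow 2).C_mul _
      · exact (hl.C_mul _).mul hhL
      · exact hg.C_mul _
  · obtain ⟨e', l', g', hl', hg', hlσ', hgσ', hpe⟩ := exists_fixed_decomposition hc hfc hpQ
    have hp2 := isHomogeneous_of_mem_linForms_mul hpQ
    by_cases he' : e' = 0
    · have hl'0 : l' ≠ 0 := by
        rintro h0
        apply hσ
        rw [hpe, he', h0]; simp [hgσ']
      have key : C e * g' ^ 2 - l * l' * g' + g * l' ^ 2 =
          l' ^ 2 * F + (-(C e * l' * c + l * l' - C e * g')) * p := by
        rw [hFe, hpe, he', C_0]; ring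
      refine ⟨C e * g' ^ 2 - l * l' * g' + g * l' ^ 2, fun h0 => ?_, ?_, ?_, _, _, key⟩
      · rw [h0] at key
        have hd : p ∣ l' ^ 2 * F :=
          ⟨C e * l' * c + l * l' - C e * g', by linear_combination -key⟩
        rcases hp.dvd_or_dvd hd with h1 | h1
        · have := degree_le_of_dvd hl'0 hp2 hl' (hp.dvd_of_dvd_pow h1)
          omega
        · exact hndvd h1
      · simp only [map_add, map_sub, map_mul, map_pow, hC, hlσ, hgσ, hlσ', hgσ']
      · refine IsHomogeneous.totalDegree_le (n := 4) ?_
        refine IsHomogeneous.add (IsHomogeneous.sub ?_ ?_) ?_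
        · exact (hg'.pow 2).C_mul _
        · exact (hl.mul hl').mul hg'
        · exact hg.mul (hl'.pow 2)
    · set l₁ := C e' * l - C e * l' with hl₁
      set g₁ := C e' * g - C e * g' with hg₁
      have hl₁h : l₁.IsHomogeneous 1 := by
        refine IsHomogeneous.sub ?_ ?_
        · exact hl.C_mul _
        · exact hl'.C_mul _
      have hg₁h : g₁.IsHomogeneous 2 := by
        refine IsHomogeneous.sub ?_ ?_
        · exact hg.C_mul _
        · exact hg'.C_mul _
      have hl₁σ : scaleAlong f c 1 l₁ = l₁ := by
        simp only [hl₁, map_sub, map_mul, hC, hlσ, hlσ']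
      have hg₁σ : scaleAlong f c 1 g₁ = g₁ := by
        simp only [hg₁, map_sub, map_mul, hC, hgσ, hgσ']
      have hD : C e' * F - C e * p = l₁ * c + g₁ := by
        rw [hFe, hpe, hl₁, hg₁]; ring
      set N := C e' * (l₁ * c - g₁) + l' * l₁ with hN
      have key : C e' * g₁ ^ 2 - l' * l₁ * g₁ + l₁ ^ 2 * g' =
          -(C e' * N) * F + (l₁ ^ 2 + C e * N) * p := by
        have h1 : (l₁ * c + g₁) * N + (C e' * g₁ ^ 2 - l' * l₁ * g₁ + l₁ ^ 2 * g') =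
            l₁ ^ 2 * p := by rw [hN, hpe]; ring
        rw [← hD] at h1
        linear_combination h1
      refine ⟨C e' * g₁ ^ 2 - l' * l₁ * g₁ + l₁ ^ 2 * g', fun h0 => ?_, ?_, ?_, _, _, key⟩
      · rw [h0] at key
        have hd : p ∣ (C e' * F) * N := ⟨l₁ ^ 2 + C e * N, by linear_combination key⟩
        rcases hp.dvd_or_dvd hd with h1 | h1
        · exact hndvd (hunit he' h1)
        have hNh : N.IsHomogeneous 2 := by
          refine IsHomogeneous.add ?_ (hl'.mul hl₁h)
          exact ((hl₁h.mul hc).sub hg₁h).C_mul _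
        obtain ⟨γ, hγ⟩ := exists_smul_eq_of_dvd hp.ne_zero hp2 hNh h1
        have hz : C (γ * e') * c ^ 2 + (C γ * l' - C e' * l₁) * c +
            (C γ * g' + C e' * g₁ - l' * l₁) = 0 := by
          have h2 : C γ * p - N = 0 := by rw [hγ, smul_eq_C_mul, sub_self]
          rw [hN, hpe] at h2
          rw [C_mul]
          linear_combination h2
        obtain ⟨ha, hb, hc'⟩ := decomposition_eq_zero hc hfc
          (by simp only [map_sub, map_mul, hC, hlσ', hl₁σ])
          (by simp only [map_sub, map_add, map_mul, hC, hgσ', hlσ', hl₁σ, hg₁σ]) hz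
        have hγ0 : γ = 0 := by simpa [he'] using ha
        have hl₁0 : l₁ = 0 := by simpa [hγ0, he'] using hb
        have hg₁0 : g₁ = 0 := by simpa [hγ0, hl₁0, he'] using hc'
        rw [hl₁0, hg₁0] at hD
        exact hndvd (hunit he' ⟨C e, by linear_combination hD⟩)
      · simp only [map_add, map_sub, map_mul, map_pow, hC, hl₁σ, hg₁σ, hlσ', hgσ']
      · refine IsHomogeneous.totalDegree_le (n := 4) ?_
        refine IsHomogeneous.add (IsHomogeneous.sub ?_ ?_) ?_
        · exact (hg₁h.pow 2).C_mul _
        · exact (hl'.mul hl₁h).mul hg₁h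
        · exact (hl₁h.pow 2).mul hg'

end Projection

theorem exists_generic_point {n : ℕ} (I : Ideal (MvPolynomial (Fin n) ℂ)) [I.IsPrime] :
    ∃ (K : Type) (_ : Field K) (_ : Algebra ℂ K) (_ : IsAlgClosed K)
      (φ : MvPolynomial (Fin n) ℂ →ₐ[ℂ] K), ∀ F, φ F = 0 ↔ F ∈ I := by
  let Q := FractionRing (MvPolynomial (Fin n) ℂ ⧸ I)
  refine ⟨AlgebraicClosure Q, inferInstance, inferInstance, inferInstance,
    (IsScalarTower.toAlgHom ℂ Q (AlgebraicClosure Q)).comp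
      ((IsScalarTower.toAlgHom ℂ (MvPolynomial (Fin n) ℂ ⧸ I) Q).comp (Ideal.Quotient.mkₐ ℂ I)),
    fun F => ?_⟩
  rw [AlgHom.comp_apply, AlgHom.comp_apply, IsScalarTower.coe_toAlgHom',
    IsScalarTower.coe_toAlgHom',
    map_eq_zero_iff _ (algebraMap Q (AlgebraicClosure Q)).injective,
    map_eq_zero_iff _ (IsFractionRing.injective (MvPolynomial (Fin n) ℂ ⧸ I) Q),
    Ideal.Quotient.mkₐ_eq_mk, Ideal.Quotient.eq_zero_iff_mem]

theorem exists_generic_point_of_prime {n : ℕ} {p : MvPolynomial (Fin n) ℂ} (hp : Prime p) :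
    ∃ (K : Type) (_ : Field K) (_ : Algebra ℂ K) (_ : IsAlgClosed K)
      (φ : MvPolynomial (Fin n) ℂ →ₐ[ℂ] K), ∀ F, φ F = 0 ↔ p ∣ F := by
  have := (Ideal.span_singleton_prime hp.ne_zero).2 hp
  obtain ⟨K, i1, i2, i3, φ, hφ⟩ := exists_generic_point (Ideal.span {p})
  exact ⟨K, i1, i2, i3, φ, fun F => by rw [hφ, Ideal.mem_span_singleton]⟩

/-- A family of quadratic forms `F i`, each a prime form `p i` or the square of a linear form `p i`,
with pairwise coprime members, such that every common zero of two members is a zero of a third. -/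
structure IsRadicalFamily {n : ℕ} {ι : Type*} (F p : ι → MvPolynomial (Fin n) ℂ) : Prop where
  mem : ∀ i, F i ∈ linForms n * linForms n
  prime : ∀ i, Prime (p i)
  eq_or : ∀ i, p i = F i ∨ (p i ∈ linForms n ∧ F i = p i ^ 2)
  not_dvd : ∀ i k, i ≠ k → ¬ p i ∣ F k
  third : ∀ {K : Type} [Field K] [Algebra ℂ K] (φ : MvPolynomial (Fin n) ℂ →ₐ[ℂ] K) (i k : ι),
    i ≠ k → φ (F i) = 0 → φ (F k) = 0 → ∃ l, l ≠ i ∧ l ≠ k ∧ φ (F l) = 0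

namespace IsRadicalFamily

variable {n : ℕ} {ι : Type*} {F p : ι → MvPolynomial (Fin n) ℂ}

theorem prime_mem (hF : IsRadicalFamily F p) (i : ι) :
    p i ∈ linForms n ∨ p i ∈ linForms n * linForms n := by
  rcases hF.eq_or i with h | h
  · right; rw [h]; exact hF.mem i
  · exact Or.inl h.1

theorem ne_zero (hF : IsRadicalFamily F p) (i : ι) : F i ≠ 0 := by
  rcases hF.eq_or i with h | h
  · rw [← h]; exact (hF.prime i).ne_zero
  · rw [h.2]; exact pow_ne_zero 2 (hF.prime i).ne_zero

theorem dvd (hF : IsRadicalFamily F p) (i : ι) : p i ∣ F i := by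
  rcases hF.eq_or i with h | h
  · rw [h]
  · rw [h.2]; exact dvd_pow_self _ two_ne_zero

theorem map_prime_eq_zero (hF : IsRadicalFamily F p) {K : Type*} [Field K] [Algebra ℂ K]
    (φ : MvPolynomial (Fin n) ℂ →ₐ[ℂ] K) (i : ι) (h : φ (F i) = 0) : φ (p i) = 0 := by
  rcases hF.eq_or i with h' | h'
  · rw [h', h]
  · rw [h'.2, map_pow] at h
    simpa using h

theorem one_le_totalDegree (hF : IsRadicalFamily F p) (i : ι) : 1 ≤ (p i).totalDegree := by
  rcases hF.prime_mem i with h | h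
  · rw [IsHomogeneous.totalDegree h (hF.prime i).ne_zero]
  · rw [(isHomogeneous_of_mem_linForms_mul h).totalDegree (hF.prime i).ne_zero]; norm_num

theorem not_prime_dvd (hF : IsRadicalFamily F p) {i k : ι} (hik : i ≠ k) : ¬ p i ∣ p k :=
  fun h => hF.not_dvd i k hik (h.trans (hF.dvd k))

theorem scaleAlong_ne (hF : IsRadicalFamily F p) {V : Submodule ℂ (MvPolynomial (Fin n) ℂ)}
    (hVL : V ≤ linForms n) {c : MvPolynomial (Fin n) ℂ} (hcL : c ∈ linForms n) {i : ι}
    (hi : F i ∈ (V ⊔ Submodule.span ℂ {c}) * (V ⊔ Submodule.span ℂ {c})) (hiV : F i ∉ V * V)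
    {f : MvPolynomial (Fin n) ℂ →ₗ[ℂ] ℂ} (hfV : ∀ l ∈ V, f l = 0) (hfc : f c = 1) :
    scaleAlong f c 1 (p i) ≠ p i := by
  intro h
  have hfix : scaleAlong f c 1 (F i) = F i := by
    rcases hF.eq_or i with h' | h'
    · rw [← h', h]
    · rw [h'.2, map_pow, h]
  obtain ⟨e, l, g, hl, hg, hFe⟩ := exists_decomposition V c hi
  have hVfix : ∀ l ∈ V, scaleAlong f c 1 l = AlgHom.id ℂ _ l := fun l hl => by
    rw [scaleAlong_apply f c 1 (hVL hl), hfV l hl]; simp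
  rw [hFe] at hfix
  simp only [map_add, map_smul, map_mul, map_pow, scaleAlong_self 1 hcL hfc, hVfix l hl,
    algHom_eq_of_mem_mul hVfix hg] at hfix
  simp at hfix
  apply hiV
  rw [hFe, hfix, zero_add]
  exact hg

/-- There is a nonzero form `R` of degree at most four vanishing at every point `φ` which can be
moved along `c` to a common zero of `F i` and `F k`. -/
theorem exists_eliminant (hF : IsRadicalFamily F p) {V : Submodule ℂ (MvPolynomial (Fin n) ℂ)}
    (hVL : V ≤ linForms n) {c : MvPolynomial (Fin n) ℂ} (hcL : c ∈ linForms n) {i : ι}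
    (hi : F i ∈ (V ⊔ Submodule.span ℂ {c}) * (V ⊔ Submodule.span ℂ {c})) (hiV : F i ∉ V * V)
    {f : MvPolynomial (Fin n) ℂ →ₗ[ℂ] ℂ} (hfV : ∀ l ∈ V, f l = 0) (hfc : f c = 1) {k : ι}
    (hik : i ≠ k) :
    ∃ R : MvPolynomial (Fin n) ℂ, R ≠ 0 ∧ R.totalDegree ≤ 4 ∧
      ∀ {K : Type} [Field K] [Algebra ℂ K] (φ : MvPolynomial (Fin n) ℂ →ₐ[ℂ] K) (κ : K),
        pointOf (shift φ.toLinearMap f κ) (F i) = 0 →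
        pointOf (shift φ.toLinearMap f κ) (F k) = 0 → φ R = 0 := by
  obtain ⟨R, hR0, hRσ, hRd, u, w, hR⟩ := _root_.exists_eliminant hcL hfc (hF.mem k) (hF.prime i)
    (hF.prime_mem i) (hF.not_dvd i k hik) (hF.scaleAlong_ne hVL hcL hi hiV hfV hfc)
  refine ⟨R, hR0, hRd, fun φ κ h1 h2 => ?_⟩
  rw [← pointOf_shift_of_fixed hcL hfc φ κ hRσ, hR, map_add, map_mul, map_mul, h2,
    hF.map_prime_eq_zero _ i h1]
  simp

theorem sum_totalDegree_le (hF : IsRadicalFamily F p) (Z : Finset ι) {R : MvPolynomial (Fin n) ℂ}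
    (hR : R ≠ 0) (h : ∀ i ∈ Z, p i ∣ R) : ∑ i ∈ Z, (p i).totalDegree ≤ R.totalDegree := by
  classical
  have hdvd : ∏ i ∈ Z, p i ∣ R := by
    refine Finset.prod_dvd_of_isRelPrime ?_ h
    intro i _ k _ hik
    exact ((hF.prime i).irreducible.isRelPrime_iff_not_dvd).2 (hF.not_prime_dvd hik)
  have hprod : (∏ i ∈ Z, p i).totalDegree = ∑ i ∈ Z, (p i).totalDegree := by
    clear hdvd h
    induction Z using Finset.induction_on with
    | empty => simp
    | insert k s hk ih =>
      rw [Finset.prod_insert hk, Finset.sum_insert hk, totalDegree_mul_of_isDomain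
        (hF.prime k).ne_zero (Finset.prod_ne_zero_iff.2 fun i _ => (hF.prime i).ne_zero), ih]
  obtain ⟨q, rfl⟩ := hdvd
  rw [totalDegree_mul_of_isDomain (left_ne_zero_of_mul hR) (right_ne_zero_of_mul hR), hprod]
  omega

theorem exists_root {K : Type*} [Field K] [Algebra ℂ K] [IsAlgClosed K] {e a b : K}
    (h : e ≠ 0 ∨ a ≠ 0) : ∃ τ : K, e * τ ^ 2 + a * τ + b = 0 := by
  have hd : (Polynomial.C e * Polynomial.X ^ 2 + Polynomial.C a * Polynomial.X +
      Polynomial.C b).degree ≠ 0 := by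
    by_cases he : e = 0
    · have ha : a ≠ 0 := by tauto
      rw [he]; simp only [map_zero, zero_mul, zero_add]
      rw [Polynomial.degree_linear ha]; norm_num
    · rw [Polynomial.degree_quadratic he]; norm_num
  obtain ⟨τ, hτ⟩ := IsAlgClosed.exists_root _ hd
  exact ⟨τ, by simpa using hτ⟩

theorem sum_totalDegree_le_of_servers (hF : IsRadicalFamily F p) [Fintype ι]
    {V : Submodule ℂ (MvPolynomial (Fin n) ℂ)}
    (hVL : V ≤ linForms n) {c : MvPolynomial (Fin n) ℂ} (hcL : c ∈ linForms n) (hcV : c ∉ V) {o : ι}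
    (ho : F o ∈ (V ⊔ Submodule.span ℂ {c}) * (V ⊔ Submodule.span ℂ {c})) (hoV : F o ∉ V * V)
    (T : Finset ι) (hT : ∀ i, i ≠ o → i ∉ T → F i ∈ V * V ∨
      ∃ c' ∈ linForms n, c' ∉ V ⊔ Submodule.span ℂ {c} ∧
        F i ∈ (V ⊔ Submodule.span ℂ {c'}) * (V ⊔ Submodule.span ℂ {c'}))
    (Z : Finset ι) (hZ : ∀ i ∈ Z, F i ∈ V * V) :
    ∑ i ∈ Z, (p i).totalDegree ≤ 4 * T.card + 1 := by
  classical
  obtain ⟨e, l, q, hl, hq, hFo⟩ := exists_decomposition V c ho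
  obtain ⟨f, hfV, hfc⟩ := exists_functional V hcV
  have hZo : ∀ i ∈ Z, i ≠ o := fun i hi h => hoV (h ▸ hZ i hi)
  choose! R hR0 hRd hR using fun k (hk : k ≠ o) =>
    hF.exists_eliminant hVL hcL ho hoV hfV hfc hk.symm
  set Z₁ := Z.filter fun i => e = 0 ∧ p i ∣ l with hZ₁
  set Z₂ := Z.filter fun i => ¬ (e = 0 ∧ p i ∣ l) with hZ₂
  have hsplit : ∑ i ∈ Z₁, (p i).totalDegree + ∑ i ∈ Z₂, (p i).totalDegree =
      ∑ i ∈ Z, (p i).totalDegree := Finset.sum_filter_add_sum_filter_not _ _ _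
  have h₁ : ∑ i ∈ Z₁, (p i).totalDegree ≤ 1 := by
    by_cases hlz : e = 0 ∧ l = 0
    · exfalso
      apply hoV
      rw [hFo, hlz.1, hlz.2]; simpa using hq
    · rcases Z₁.eq_empty_or_nonempty with h | ⟨i, hi⟩
      · simp [h]
      have he : e = 0 := (Finset.mem_filter.1 hi).2.1
      have hl0 : l ≠ 0 := fun h => hlz ⟨he, h⟩
      refine (hF.sum_totalDegree_le Z₁ hl0 fun i hi => (Finset.mem_filter.1 hi).2.2).trans ?_
      exact IsHomogeneous.totalDegree_le (hVL hl)
  have hserve : ∀ i ∈ Z₂, ∃ k ∈ T, k ≠ o ∧ p i ∣ R k := by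
    intro i hi
    obtain ⟨hiZ, hex⟩ := Finset.mem_filter.1 hi
    obtain ⟨K, _, _, _, φ, hφ⟩ := exists_generic_point_of_prime (hF.prime i)
    have hcoef : algebraMap ℂ K e ≠ 0 ∨ φ l ≠ 0 := by
      by_contra! h
      exact hex ⟨by simpa using h.1, (hφ l).1 h.2⟩
    obtain ⟨τ, hτ⟩ := exists_root (b := φ q) hcoef
    set g₀ := shift φ.toLinearMap f (τ - φ c) with hg₀
    have hg₀V : ∀ l ∈ V, g₀ l = φ l := fun l hl => by simp [hg₀, hfV l hl]
    have hg₀c : g₀ c = τ := by simp [hg₀, hfc]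
    set W := V ⊔ Submodule.span ℂ {c} with hW
    have hWL : W ≤ linForms n := sup_le hVL (by simpa using hcL)
    have hio : ∀ g ∈ agreeOn W g₀, pointOf g (F i) = 0 ∧ pointOf g (F o) = 0 := by
      intro g hg
      have hgV : ∀ l ∈ V, g l = φ l := fun l hl =>
        (hg l (le_sup_left (a := V) hl)).trans (hg₀V l hl)
      have hgc : g c = τ := (hg c (Submodule.mem_sup_right
        (Submodule.mem_span_singleton_self c))).trans hg₀c
      constructor
      · rw [pointOf_eq_of_mem_mul g φ hVL hgV (hZ i hiZ)]
        exact (hφ _).2 (hF.dvd i)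
      · rw [hFo]
        simp only [map_add, map_smul, map_mul, map_pow, pointOf_apply_of_mem g hcL,
          pointOf_apply_of_mem g (hVL hl), hgV l hl, hgc, pointOf_eq_of_mem_mul g φ hVL hgV hq]
        rw [Algebra.smul_def]; exact hτ
    obtain ⟨k, hk, hkA⟩ := (lineClosed_agreeOn W g₀).exists_forall_eq_zero
      ⟨g₀, self_mem_agreeOn W g₀⟩ ((Finset.univ.erase i).erase o) F hF.mem (fun g hg => by
        obtain ⟨k, hki, hko, hk⟩ := hF.third (pointOf g) i o (hZo i hiZ) (hio g hg).1 (hio g hg).2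
        exact ⟨k, by simp [hki, hko], hk⟩)
    simp only [Finset.mem_erase, Finset.mem_univ, and_true] at hk
    have hkφ : φ (F k) ≠ 0 := fun h => hF.not_dvd i k hk.2.symm ((hφ _).1 h)
    have hkT : k ∈ T := by
      by_contra hkT
      rcases hT k hk.1 hkT with h | ⟨c', hc'L, hc'W, h⟩
      · apply hkφ
        rw [← pointOf_eq_of_mem_mul g₀ φ hVL hg₀V h]
        exact hkA g₀ (self_mem_agreeOn W g₀)
      · exact hkφ (eq_zero_of_forall_agreeOn hVL le_sup_left φ g₀ hg₀V hc'L hc'W h hkA)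
    refine ⟨k, hkT, hk.1, (hφ _).1 (hR k hk.1 φ (τ - φ c) ?_ ?_)⟩
    · exact (hio g₀ (self_mem_agreeOn W g₀)).2
    · exact hkA g₀ (self_mem_agreeOn W g₀)
  choose! k hkT hko hkd using hserve
  have h₂ : ∑ i ∈ Z₂, (p i).totalDegree ≤ 4 * T.card := by
    rw [← Finset.sum_fiberwise_of_maps_to hkT]
    calc _ ≤ ∑ j ∈ T, 4 := by
          refine Finset.sum_le_sum fun j _ => ?_
          rcases (Z₂.filter fun i => k i = j).eq_empty_or_nonempty with h | ⟨i, hi⟩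
          · rw [h]; simp
          obtain ⟨hiZ, rfl⟩ := Finset.mem_filter.1 hi
          refine (hF.sum_totalDegree_le _ (hR0 _ (hko i hiZ)) fun i' hi' => ?_).trans
            (hRd _ (hko i hiZ))
          obtain ⟨hiZ', h⟩ := Finset.mem_filter.1 hi'
          rw [← h]; exact hkd i' hiZ'
      _ = 4 * T.card := by rw [Finset.sum_const, smul_eq_mul, mul_comm]
  omega

end IsRadicalFamily

/-- The members `F i`, `i ∈ I`, of a family that are quadratic in `V` and one further linear form
`c i`, together with the values `s i` of `c i` at which `F i` vanishes over a generic point `φ`. -/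
structure Pencil {n : ℕ} {ι : Type*} (F : ι → MvPolynomial (Fin n) ℂ)
    (V : Submodule ℂ (MvPolynomial (Fin n) ℂ)) (K : Type) [Field K] [Algebra ℂ K] where
  φ : MvPolynomial (Fin n) ℂ →ₐ[ℂ] K
  injective : ∀ G, φ G = 0 → G = 0
  I : Finset ι
  c : ι → MvPolynomial (Fin n) ℂ
  s : ι → Finset K
  U : Submodule ℂ (MvPolynomial (Fin n) ℂ)
  disjoint : Disjoint V U
  le : V ≤ linForms n
  c_mem : ∀ i ∈ I, c i ∈ linForms n
  c_mem_U : ∀ i ∈ I, c i ∈ U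
  mem : ∀ i ∈ I, F i ∈ (V ⊔ Submodule.span ℂ {c i}) * (V ⊔ Submodule.span ℂ {c i})
  notMem : ∀ i ∈ I, F i ∉ V * V
  root_iff : ∀ i ∈ I, ∀ g : MvPolynomial (Fin n) ℂ →ₗ[ℂ] K, (∀ l ∈ V, g l = φ l) →
    (pointOf g (F i) = 0 ↔ g (c i) ∈ s i)
  nonempty : ∀ i ∈ I, (s i).Nonempty
  card_le : ∀ i ∈ I, (s i).card ≤ 2

namespace Pencil

variable {n : ℕ} {ι : Type*} {F p : ι → MvPolynomial (Fin n) ℂ}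
  {V : Submodule ℂ (MvPolynomial (Fin n) ℂ)} {K : Type} [Field K] [Algebra ℂ K]
  (A : Pencil F V K)

theorem c_notMem {i : ι} (hi : i ∈ A.I) : A.c i ∉ V := fun h => A.notMem i hi <| by
  have := A.mem i hi
  rwa [sup_eq_left.2 ((Submodule.span_singleton_le_iff_mem _ _).2 h)] at this

theorem c_ne_zero {i : ι} (hi : i ∈ A.I) : A.c i ≠ 0 := fun h =>
  A.c_notMem hi (h ▸ V.zero_mem)

/-- The pairs of an index and a root. -/
abbrev Pt : Type _ := {x : Σ _ : ι, K // x ∈ A.I.sigma A.s}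

variable {A}

theorem Pt.mem_I (x : A.Pt) : x.1.1 ∈ A.I := (Finset.mem_sigma.1 x.2).1

theorem Pt.mem_s (x : A.Pt) : x.1.2 ∈ A.s x.1.1 := (Finset.mem_sigma.1 x.2).2

variable (A)

/-- The vector in `S × K` attached to a point. -/
def vec (x : A.Pt) : MvPolynomial (Fin n) ℂ × K := (A.c x.1.1, x.1.2)

/-- The points of the flat attached to `x`. -/
def flat (x : A.Pt) : Set (MvPolynomial (Fin n) ℂ →ₗ[ℂ] K) :=
  {g | (∀ l ∈ V, g l = A.φ l) ∧ g (A.c x.1.1) = x.1.2}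

variable {A}

theorem lineClosed_flat (x : A.Pt) : LineClosed (A.flat x) := by
  intro g hg g' hg' t
  refine ⟨fun l hl => ?_, ?_⟩
  · simp [hg.1 l hl, hg'.1 l hl]
  · simp [hg.2, hg'.2]

theorem eq_zero_of_mem_flat {x : A.Pt} {g : MvPolynomial (Fin n) ℂ →ₗ[ℂ] K} (hg : g ∈ A.flat x) :
    pointOf g (F x.1.1) = 0 := by
  rw [A.root_iff _ x.mem_I g hg.1, hg.2]; exact x.mem_s

theorem exists_mem_flat_ne_zero (hF : IsRadicalFamily F p) (x : A.Pt) :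
    ∃ g ∈ A.flat x, ∀ k, k ≠ x.1.1 → pointOf g (F k) ≠ 0 := by
  obtain ⟨f, hfV, hfc⟩ := exists_functional V (A.c_notMem x.mem_I)
  have hg : shift A.φ.toLinearMap f (x.1.2 - A.φ (A.c x.1.1)) ∈ A.flat x :=
    ⟨fun l hl => by simp [hfV l hl], by simp [hfc]⟩
  refine ⟨_, hg, fun k hk h0 => ?_⟩
  obtain ⟨R, hR0, -, hR⟩ := hF.exists_eliminant A.le (A.c_mem _ x.mem_I) (A.mem _ x.mem_I)
    (A.notMem _ x.mem_I) hfV hfc hk.symm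
  exact hR0 (A.injective _ (hR A.φ _ (eq_zero_of_mem_flat hg) h0))

theorem linearIndependent_vec (hF : IsRadicalFamily F p) (x y : A.Pt) (hxy : x ≠ y) :
    LinearIndependent ℂ ![A.vec x, A.vec y] := by
  have hx0 : A.vec x ≠ 0 := fun h => A.c_ne_zero x.mem_I (congrArg Prod.fst h)
  rw [LinearIndependent.pair_iff' hx0]
  intro a ha
  have h1 : a • A.c x.1.1 = A.c y.1.1 := congrArg Prod.fst ha
  have h2 : a • x.1.2 = y.1.2 := congrArg Prod.snd ha
  by_cases hi : y.1.1 = x.1.1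
  · have ha1 : a = 1 := by
      have : (a - 1) • A.c x.1.1 = 0 := by rw [sub_smul, h1, hi]; simp
      rcases smul_eq_zero.1 this with h | h
      · exact sub_eq_zero.1 h
      · exact absurd h (A.c_ne_zero x.mem_I)
    apply hxy
    apply Subtype.ext
    obtain ⟨⟨i, τ⟩, hx⟩ := x
    obtain ⟨⟨j, σ⟩, hy⟩ := y
    simp only at hi h2
    subst hi
    rw [ha1, one_smul] at h2
    subst h2
    rfl
  · obtain ⟨g, hg, hne⟩ := exists_mem_flat_ne_zero hF x
    refine hne _ hi ?_
    rw [A.root_iff _ y.mem_I g hg.1, ← h1, map_smul, hg.2, h2]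
    exact y.mem_s

theorem c_notMem_sup {x y : A.Pt} (h : A.c y.1.1 ∉ Submodule.span ℂ {A.c x.1.1}) :
    A.c y.1.1 ∉ V ⊔ Submodule.span ℂ {A.c x.1.1} := by
  intro hm
  obtain ⟨v, hv, w, hw, hvw⟩ := Submodule.mem_sup.1 hm
  apply h
  have hwU : w ∈ A.U :=
    (Submodule.span_singleton_le_iff_mem _ _).2 (A.c_mem_U _ x.mem_I) hw
  have hvU : v ∈ A.U := by
    have : v = A.c y.1.1 - w := by rw [← hvw]; simp
    rw [this]; exact A.U.sub_mem (A.c_mem_U _ y.mem_I) hwU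
  have hv0 : v = 0 := Submodule.disjoint_def.1 A.disjoint v hv hvU
  rw [hv0, zero_add] at hvw
  rwa [← hvw]

theorem exists_mem_flat_inter {x y : A.Pt} (h : A.c y.1.1 ∉ Submodule.span ℂ {A.c x.1.1}) :
    ∃ g ∈ A.flat x, g ∈ A.flat y := by
  obtain ⟨g₁, hg₁, hg₁c⟩ :=
    exists_agreeOn_apply_eq V A.φ.toLinearMap (A.c_notMem x.mem_I) x.1.2
  obtain ⟨g, hg, hgc⟩ := exists_agreeOn_apply_eq _ g₁ (c_notMem_sup h) y.1.2
  have hgV : ∀ l ∈ V, g l = A.φ l := fun l hl =>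
    (hg l (Submodule.mem_sup_left hl)).trans (hg₁ l hl)
  exact ⟨g, ⟨hgV, (hg _ (Submodule.mem_sup_right
    (Submodule.mem_span_singleton_self _))).trans hg₁c⟩, hgV, hgc⟩

/-- If `c k` is, modulo `V`, a combination of the linear forms attached to two points, then it is
one exactly. -/
theorem exists_combination {x y : A.Pt} {k : ι} (hk : k ∈ A.I)
    (hm : A.c k ∈ V ⊔ Submodule.span ℂ {A.c x.1.1, A.c y.1.1}) :
    ∃ α β : ℂ, α • A.c x.1.1 + β • A.c y.1.1 = A.c k := by
  obtain ⟨v, hv, w, hw, hvw⟩ := Submodule.mem_sup.1 hm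
  have hwU : w ∈ A.U := by
    refine Submodule.span_le.2 ?_ hw
    rintro _ (rfl | rfl)
    exacts [A.c_mem_U _ x.mem_I, A.c_mem_U _ y.mem_I]
  have hvU : v ∈ A.U := by
    have : v = A.c k - w := by rw [← hvw]; simp
    rw [this]; exact A.U.sub_mem (A.c_mem_U _ hk) hwU
  have hv0 : v = 0 := Submodule.disjoint_def.1 A.disjoint v hv hvU
  rw [hv0, zero_add] at hvw
  rw [← hvw]
  exact Submodule.mem_span_pair.1 hw

theorem mem_flat_inter_of_agreeOn {x y : A.Pt} {g₀ g : MvPolynomial (Fin n) ℂ →ₗ[ℂ] K}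
    (hx : g₀ ∈ A.flat x) (hy : g₀ ∈ A.flat y)
    (hg : g ∈ agreeOn (V ⊔ Submodule.span ℂ {A.c x.1.1, A.c y.1.1}) g₀) :
    g ∈ A.flat x ∧ g ∈ A.flat y := by
  have hV : ∀ l ∈ V, g l = A.φ l := fun l hl =>
    (hg l (Submodule.mem_sup_left hl)).trans (hx.1 l hl)
  refine ⟨⟨hV, ?_⟩, ⟨hV, ?_⟩⟩
  · rw [hg _ (Submodule.mem_sup_right (Submodule.subset_span (by simp))), hx.2]
  · rw [hg _ (Submodule.mem_sup_right (Submodule.subset_span (by simp))), hy.2]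

theorem collinear_or_third [Fintype ι] (hF : IsRadicalFamily F p) {P : Finset ι}
    (hP : ∀ i, i ∉ A.I → i ∉ P → F i ∈ V * V) {x y : A.Pt}
    (h : A.c y.1.1 ∉ Submodule.span ℂ {A.c x.1.1}) :
    (∃ z, CollinearTriple A.vec (x, y, z)) ∨
      ∃ i ∈ P, ∀ g ∈ A.flat x, g ∈ A.flat y → pointOf g (F i) = 0 := by
  classical
  have hne : x.1.1 ≠ y.1.1 := by
    intro he
    rw [he] at h
    exact h (Submodule.mem_span_singleton_self _)
  obtain ⟨g₀, hgx, hgy⟩ := exists_mem_flat_inter h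
  have hclosed : LineClosed (A.flat x ∩ A.flat y) := fun g hg g' hg' t =>
    ⟨lineClosed_flat x g hg.1 g' hg'.1 t, lineClosed_flat y g hg.2 g' hg'.2 t⟩
  obtain ⟨k, hk, hkA⟩ := hclosed.exists_forall_eq_zero ⟨g₀, hgx, hgy⟩
    ((Finset.univ.erase x.1.1).erase y.1.1) F hF.mem (fun g hg => by
      obtain ⟨k, hkx, hky, hk⟩ := hF.third (pointOf g) _ _ hne (eq_zero_of_mem_flat hg.1)
        (eq_zero_of_mem_flat hg.2)
      exact ⟨k, by simp [hkx, hky], hk⟩)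
  simp only [Finset.mem_erase, Finset.mem_univ, and_true] at hk
  by_cases hkP : k ∈ P
  · exact Or.inr ⟨k, hkP, fun g hx hy => hkA g ⟨hx, hy⟩⟩
  left
  have hkφ : A.φ (F k) ≠ 0 := fun h => hF.ne_zero k (A.injective _ h)
  have hkI : k ∈ A.I := by
    by_contra hkI
    apply hkφ
    rw [← pointOf_eq_of_mem_mul g₀ A.φ A.le hgx.1 (hP k hkI hkP)]
    exact hkA g₀ ⟨hgx, hgy⟩
  have hkm : A.c k ∈ V ⊔ Submodule.span ℂ {A.c x.1.1, A.c y.1.1} := by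
    by_contra hkm
    exact hkφ (eq_zero_of_forall_agreeOn A.le le_sup_left A.φ g₀ hgx.1 (A.c_mem k hkI) hkm
      (A.mem k hkI) fun g hg => hkA g (mem_flat_inter_of_agreeOn hgx hgy hg))
  obtain ⟨α, β, hαβ⟩ := exists_combination hkI hkm
  have hval : g₀ (A.c k) = α • x.1.2 + β • y.1.2 := by
    rw [← hαβ, map_add, map_smul, map_smul, hgx.2, hgy.2]
  have hroot := (A.root_iff k hkI g₀ hgx.1).1 (hkA g₀ ⟨hgx, hgy⟩)
  refine ⟨⟨⟨k, g₀ (A.c k)⟩, Finset.mem_sigma.2 ⟨hkI, hroot⟩⟩, ?_, ?_, ?_, ?_⟩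
  · exact fun he => hne (congrArg (fun x : A.Pt => x.1.1) he)
  · exact fun he => hk.2 (congrArg (fun x : A.Pt => x.1.1) he)
  · exact fun he => hk.1 (congrArg (fun x : A.Pt => x.1.1) he)
  · refine Submodule.mem_span_pair.2 ⟨α, β, ?_⟩
    exact Prod.ext hαβ hval.symm

/-- If no third vector lies on the line through the vectors of `x` and `y`, then the intersection
of the flats of `x` and `y` is not contained in a third flat. -/
theorem exists_mem_flat_apply_ne (x y z : A.Pt) (hxz : x ≠ z) (hyz : y ≠ z)
    (h : A.c y.1.1 ∉ Submodule.span ℂ {A.c x.1.1})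
    (hns : ¬ ∃ w, CollinearTriple A.vec (x, y, w)) :
    ∃ g ∈ A.flat x, g ∈ A.flat y ∧ g (A.c z.1.1) ≠ z.1.2 := by
  by_contra! hcon
  obtain ⟨g₀, hgx, hgy⟩ := exists_mem_flat_inter h
  have hm : A.c z.1.1 ∈ V ⊔ Submodule.span ℂ {A.c x.1.1, A.c y.1.1} := by
    by_contra hm
    obtain ⟨g, hg, hgc⟩ := exists_agreeOn_apply_eq _ g₀ hm (z.1.2 + 1)
    obtain ⟨h1, h2⟩ := mem_flat_inter_of_agreeOn hgx hgy hg
    have := hcon g h1 h2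
    rw [hgc] at this
    simp at this
  obtain ⟨α, β, hαβ⟩ := exists_combination z.mem_I hm
  refine hns ⟨z, ?_, hxz.symm, hyz.symm, ?_⟩
  · intro he
    have he' : x = y := he
    subst he'
    exact h (Submodule.mem_span_singleton_self _)
  · refine Submodule.mem_span_pair.2 ⟨α, β, Prod.ext hαβ ?_⟩
    have h1 : g₀ (A.c z.1.1) = α • x.1.2 + β • y.1.2 := by
      rw [← hαβ, map_add, map_smul, map_smul, hgx.2, hgy.2]
    exact h1.symm.trans (hcon g₀ hgx hgy)

theorem not_three_of_vanishing (hF : IsRadicalFamily F p) (x : A.Pt) (y : Fin 3 → A.Pt)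
    (hinj : Function.Injective y)
    (hc : ∀ a, A.c (y a).1.1 ∉ Submodule.span ℂ {A.c x.1.1})
    (hns : ∀ a, ¬ ∃ w, CollinearTriple A.vec (x, y a, w)) {i : ι} (hi : i ≠ x.1.1)
    (hvan : ∀ a, ∀ g ∈ A.flat x, g ∈ A.flat (y a) → pointOf g (F i) = 0) : False := by
  obtain ⟨φ, hφ, hφne⟩ := exists_mem_flat_ne_zero hF x
  have hφi := hφne i hi
  set H : Fin 3 → (MvPolynomial (Fin n) ℂ →ₗ[ℂ] K) → K :=
    fun a g => g (A.c (y a).1.1) - (y a).1.2 with hH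
  have hHy : ∀ a, ∀ g ∈ A.flat x, H a g = 0 → g ∈ A.flat (y a) := fun a g hg h =>
    ⟨hg.1, sub_eq_zero.1 h⟩
  have hHφ : ∀ a, H a φ ≠ 0 := fun a h => hφi (hvan a φ hφ (hHy a φ hφ h))
  have hxy : ∀ a, x ≠ y a := fun a h =>
    hc a (by rw [← h]; exact Submodule.mem_span_singleton_self _)
  have hHline : ∀ a (g g' : MvPolynomial (Fin n) ℂ →ₗ[ℂ] K) (t : K),
      H a (g + t • (g' - g)) = H a g + t * (H a g' - H a g) := by
    intro a g g' t
    simp [hH]; ring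
  obtain ⟨ψ, hψ, hψne⟩ := (lineClosed_flat x).exists_ne_zero ⟨φ, hφ⟩
    (Finset.univ : Finset (Fin 3 × Fin 3))
    (fun ab g => if ab.1 = ab.2 then H ab.1 g - H ab.1 φ else
      H ab.1 φ * H ab.2 g - H ab.2 φ * H ab.1 g) (by
      rintro ⟨a, b⟩ - g g'
      by_cases hab : a = b
      · refine ⟨Polynomial.C (H a g - H a φ) + Polynomial.C (H a g' - H a g) * Polynomial.X,
          fun t => ?_⟩
        simp only [hab, if_true, hHline]
        simp; ring
      · refine ⟨Polynomial.C (H a φ * H b g - H b φ * H a g) +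
          Polynomial.C (H a φ * (H b g' - H b g) - H b φ * (H a g' - H a g)) * Polynomial.X,
          fun t => ?_⟩
        simp only [hab, if_false, hHline]
        simp; ring) (by
      rintro ⟨a, b⟩ -
      by_cases hab : a = b
      · obtain ⟨g, hg, hgy⟩ := exists_mem_flat_inter (hc a)
        refine ⟨g, hg, ?_⟩
        have : H a g = 0 := sub_eq_zero.2 hgy.2
        simp only [hab, if_true]
        rw [← hab, this, zero_sub]
        exact neg_ne_zero.2 (hHφ a)
      · obtain ⟨g, hg, hgy, hgb⟩ := exists_mem_flat_apply_ne x (y a) (y b) (hxy b)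
          (fun h => hab (hinj h)) (hc a) (hns a)
        refine ⟨g, hg, ?_⟩
        have : H a g = 0 := sub_eq_zero.2 hgy.2
        simp only [hab, if_false]
        rw [this, mul_zero, sub_zero]
        exact mul_ne_zero (hHφ a) (sub_ne_zero.2 hgb))
  have h1 : ∀ a, H a φ - H a ψ ≠ 0 := fun a h => by
    have := hψne (a, a) (Finset.mem_univ _)
    simp only [if_true] at this
    exact this (by linear_combination -h)
  have h2 : ∀ a b, a ≠ b → H a φ * H b ψ - H b φ * H a ψ ≠ 0 := fun a b hab => by
    have := hψne (a, b) (Finset.mem_univ _)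
    simpa only [hab, if_false] using this
  set t : Fin 3 → K := fun a => H a φ / (H a φ - H a ψ) with ht
  have htinj : Function.Injective t := by
    intro a b hab
    by_contra hne
    apply h2 a b hne
    simp only [ht] at hab
    rw [div_eq_div_iff (h1 a) (h1 b)] at hab
    linear_combination -hab
  obtain ⟨q, hqd, hq⟩ := exists_polynomial_along_line φ ψ (hF.mem i)
  have hroot : ∀ a, q.eval (t a) = 0 := by
    intro a
    rw [hq]
    refine hvan a _ (lineClosed_flat x φ hφ ψ hψ _) (hHy a _ (lineClosed_flat x φ hφ ψ hψ _) ?_)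
    rw [hHline]
    simp only [ht]
    field_simp [h1 a]
    ring
  have hq0 : q = 0 := by
    refine Polynomial.eq_zero_of_natDegree_lt_card_of_eval_eq_zero q htinj hroot ?_
    simp; omega
  apply hφi
  have := hq 0
  rw [hq0] at this
  simpa using this.symm

end Pencil

theorem exists_root_finset {K : Type*} [Field K] [Algebra ℂ K] [IsAlgClosed K] {e a b : K}
    (h : e ≠ 0 ∨ a ≠ 0) :
    ∃ s : Finset K, s.Nonempty ∧ s.card ≤ 2 ∧ ∀ τ, τ ∈ s ↔ e * τ ^ 2 + a * τ + b = 0 := by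
  classical
  set q : Polynomial K := Polynomial.C e * Polynomial.X ^ 2 + Polynomial.C a * Polynomial.X +
      Polynomial.C b with hq
  have hq0 : q ≠ 0 := by
    intro h0
    have h2 : q.coeff 2 = e := by simp [hq]
    have h1 : q.coeff 1 = a := by simp [hq, Polynomial.coeff_C]
    rw [h0] at h1 h2
    simp at h1 h2
    tauto
  have hmem : ∀ τ, τ ∈ q.roots.toFinset ↔ e * τ ^ 2 + a * τ + b = 0 := fun τ => by
    rw [Multiset.mem_toFinset, Polynomial.mem_roots hq0, Polynomial.IsRoot, hq]
    simp
  refine ⟨q.roots.toFinset, ?_, ?_, hmem⟩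
  · obtain ⟨τ, hτ⟩ := IsRadicalFamily.exists_root (b := b) h
    exact ⟨τ, (hmem τ).2 hτ⟩
  · refine (Multiset.toFinset_card_le _).trans ((Polynomial.card_roots' q).trans ?_)
    rw [hq]; compute_degree

/-- A linear form may be replaced by its component in a complement. -/
theorem exists_mem_complement {E : Type*} [AddCommGroup E] [Module ℂ E] {V U L : Submodule ℂ E}
    (hVU : IsCompl V U) (hVL : V ≤ L) {c : E} (hc : c ∈ L) :
    ∃ c' ∈ U, c' ∈ L ∧ V ⊔ Submodule.span ℂ {c'} = V ⊔ Submodule.span ℂ {c} := by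
  obtain ⟨v, hv, u, hu, huv⟩ := Submodule.mem_sup.1
    (hVU.sup_eq_top ▸ Submodule.mem_top : c ∈ V ⊔ U)
  have hu' : u = c - v := by rw [← huv]; abel
  refine ⟨u, hu, hu' ▸ L.sub_mem hc (hVL hv), le_antisymm (sup_le le_sup_left ?_)
    (sup_le le_sup_left ?_)⟩
  · rw [Submodule.span_singleton_le_iff_mem, hu']
    exact Submodule.sub_mem _ (Submodule.mem_sup_right (Submodule.mem_span_singleton_self _))
      (Submodule.mem_sup_left hv)
  · rw [Submodule.span_singleton_le_iff_mem, ← huv]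
    exact Submodule.add_mem _ (Submodule.mem_sup_left hv)
      (Submodule.mem_sup_right (Submodule.mem_span_singleton_self _))

theorem exists_root_finset_pointOf {n : ℕ} {V : Submodule ℂ (MvPolynomial (Fin n) ℂ)}
    {K : Type*} [Field K] [Algebra ℂ K] [IsAlgClosed K] {φ : MvPolynomial (Fin n) ℂ →ₐ[ℂ] K}
    (hφ : ∀ G, φ G = 0 → G = 0)
    (hVL : V ≤ linForms n) {c F : MvPolynomial (Fin n) ℂ} (hcL : c ∈ linForms n)
    (hF : F ∈ (V ⊔ Submodule.span ℂ {c}) * (V ⊔ Submodule.span ℂ {c})) (hFV : F ∉ V * V) :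
    ∃ s : Finset K, s.Nonempty ∧ s.card ≤ 2 ∧
      ∀ g : MvPolynomial (Fin n) ℂ →ₗ[ℂ] K, (∀ l ∈ V, g l = φ l) →
        (pointOf g F = 0 ↔ g c ∈ s) := by
  obtain ⟨e, l, q, hl, hq, rfl⟩ := exists_decomposition V c hF
  have hcoef : algebraMap ℂ K e ≠ 0 ∨ φ l ≠ 0 := by
    by_contra! h
    apply hFV
    rw [(map_eq_zero _).1 h.1, hφ l h.2]
    simpa using hq
  obtain ⟨s, hs, hs2, hsm⟩ := exists_root_finset (b := φ q) hcoef
  refine ⟨s, hs, hs2, fun g hg => ?_⟩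
  rw [hsm]
  simp only [map_add, map_smul, map_mul, map_pow, pointOf_apply_of_mem g hcL,
    pointOf_apply_of_mem g (hVL hl), hg l hl, pointOf_eq_of_mem_mul g φ hVL hg hq]
  rw [Algebra.smul_def]

theorem exists_pencil {n : ℕ} {ι : Type*} [Fintype ι] {F : ι → MvPolynomial (Fin n) ℂ}
    {V : Submodule ℂ (MvPolynomial (Fin n) ℂ)} (hVL : V ≤ linForms n) (P : Finset ι)
    (hS : ∀ i, i ∉ P → ∃ c ∈ linForms n,
      F i ∈ (V ⊔ Submodule.span ℂ {c}) * (V ⊔ Submodule.span ℂ {c})) :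
    ∃ (K : Type) (_ : Field K) (_ : Algebra ℂ K) (A : Pencil F V K),
      ∀ i, i ∈ A.I ↔ i ∉ P ∧ F i ∉ V * V := by
  classical
  obtain ⟨U, hU⟩ := V.exists_isCompl
  obtain ⟨K, _, _, _, φ, hφ⟩ := exists_generic_point (⊥ : Ideal (MvPolynomial (Fin n) ℂ))
  have hφ' : ∀ G, φ G = 0 → G = 0 := fun G h => by simpa using (hφ G).1 h
  have hS' : ∀ i, i ∉ P → ∃ c ∈ U, c ∈ linForms n ∧
      F i ∈ (V ⊔ Submodule.span ℂ {c}) * (V ⊔ Submodule.span ℂ {c}) := fun i hi => by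
    obtain ⟨c, hc, hFc⟩ := hS i hi
    obtain ⟨c', h1, h2, h3⟩ := exists_mem_complement hU hVL hc
    exact ⟨c', h1, h2, h3 ▸ hFc⟩
  choose! c hcU hcL hc using hS'
  have hroot := fun i (hi : i ∉ P ∧ F i ∉ V * V) =>
    exists_root_finset_pointOf hφ' hVL (hcL i hi.1) (hc i hi.1) hi.2
  choose! s hs hs2 hsr using hroot
  have hI : ∀ i, i ∈ (Finset.univ.filter fun i => i ∉ P ∧ F i ∉ V * V) ↔
      i ∉ P ∧ F i ∉ V * V := fun i => by simp
  exact ⟨K, inferInstance, inferInstance,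
    { φ := φ, injective := hφ', I := Finset.univ.filter fun i => i ∉ P ∧ F i ∉ V * V
      c := c, s := s, U := U, disjoint := hU.disjoint, le := hVL
      c_mem := fun i hi => hcL i ((hI i).1 hi).1
      c_mem_U := fun i hi => hcU i ((hI i).1 hi).1
      mem := fun i hi => hc i ((hI i).1 hi).1
      notMem := fun i hi => ((hI i).1 hi).2
      root_iff := fun i hi => hsr i ((hI i).1 hi)
      nonempty := fun i hi => hs i ((hI i).1 hi)
      card_le := fun i hi => hs2 i ((hI i).1 hi) }, hI⟩

namespace Pencil

variable {n : ℕ} {ι : Type*} {F p : ι → MvPolynomial (Fin n) ℂ}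
  {V : Submodule ℂ (MvPolynomial (Fin n) ℂ)} {K : Type} [Field K] [Algebra ℂ K]
  {A : Pencil F V K}

theorem exists_pt {i : ι} (hi : i ∈ A.I) : ∃ x : A.Pt, x.1.1 = i := by
  obtain ⟨τ, hτ⟩ := A.nonempty i hi
  exact ⟨⟨⟨i, τ⟩, Finset.mem_sigma.2 ⟨hi, hτ⟩⟩, rfl⟩

theorem card_filter_pt (f : ι → Prop) [DecidablePred f] :
    (A.I.filter f).card ≤ (Finset.univ.filter fun x : A.Pt => f x.1.1).card ∧
      (Finset.univ.filter fun x : A.Pt => f x.1.1).card ≤ 2 * (A.I.filter f).card := by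
  classical
  constructor
  · refine (Finset.card_le_card (t := (Finset.univ.filter fun x : A.Pt => f x.1.1).image
      fun x => x.1.1) fun i hi => ?_).trans Finset.card_image_le
    obtain ⟨hiI, hif⟩ := Finset.mem_filter.1 hi
    obtain ⟨x, rfl⟩ := exists_pt hiI
    exact Finset.mem_image.2 ⟨x, by simpa using hif, rfl⟩
  · have h1 : (Finset.univ.filter fun x : A.Pt => f x.1.1).card ≤
        ((A.I.filter f).sigma A.s).card := by
      refine Finset.card_le_card_of_injOn (fun x => x.1) (fun x hx => ?_)
        (Subtype.val_injective.injOn)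
      have hx' : f x.1.1 := by simpa using hx
      exact Finset.mem_sigma.2 ⟨Finset.mem_filter.2 ⟨x.mem_I, hx'⟩, x.mem_s⟩
    refine h1.trans ?_
    rw [Finset.card_sigma]
    calc _ ≤ ∑ i ∈ A.I.filter f, 2 :=
          Finset.sum_le_sum fun i hi => A.card_le i (Finset.mem_filter.1 hi).1
      _ = _ := by rw [Finset.sum_const, smul_eq_mul, mul_comm]

theorem servers_bound [Fintype ι] [DecidableEq ι] (hF : IsRadicalFamily F p) {P : Finset ι}
    (hI : ∀ i, i ∈ A.I ↔ i ∉ P ∧ F i ∉ V * V) {o : ι} (ho : o ∈ A.I) (D : Finset ι)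
    (hD : ∀ i ∈ A.I, A.c i ∈ Submodule.span ℂ {A.c o} → i ∈ D)
    (Z : Finset ι) (hZ : ∀ i ∈ Z, F i ∈ V * V) :
    ∑ i ∈ Z, (p i).totalDegree ≤ 4 * (P.card + (D.card - 1)) + 1 := by
  have hT := hF.sum_totalDegree_le_of_servers A.le (A.c_mem o ho) (A.c_notMem ho) (A.mem o ho)
    (A.notMem o ho) (P ∪ D.erase o) (fun i hio hiT => by
      by_cases hiV : F i ∈ V * V
      · exact Or.inl hiV
      right
      simp only [Finset.mem_union, Finset.mem_erase, not_or, not_and] at hiT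
      have hiI : i ∈ A.I := (hI i).2 ⟨hiT.1, hiV⟩
      refine ⟨A.c i, A.c_mem i hiI, ?_, A.mem i hiI⟩
      obtain ⟨x, rfl⟩ := exists_pt ho
      obtain ⟨y, rfl⟩ := exists_pt hiI
      exact c_notMem_sup fun h => hiT.2 hio (hD _ hiI h)) Z hZ
  have hoD : o ∈ D := hD o ho (Submodule.mem_span_singleton_self _)
  have := Finset.card_union_le P (D.erase o)
  rw [Finset.card_erase_of_mem hoD] at this
  omega

theorem card_bad_le [Fintype ι] (hF : IsRadicalFamily F p) {P : Finset ι}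
    (hI : ∀ i, i ∈ A.I ↔ i ∉ P ∧ F i ∉ V * V) (x : A.Pt) (B : Finset A.Pt)
    (hB : ∀ y ∈ B, A.c y.1.1 ∉ Submodule.span ℂ {A.c x.1.1} ∧
      ¬ ∃ z, CollinearTriple A.vec (x, y, z)) : B.card ≤ 2 * P.card := by
  classical
  have hP : ∀ i, i ∉ A.I → i ∉ P → F i ∈ V * V := fun i hiI hiP => by
    by_contra h
    exact hiI ((hI i).2 ⟨hiP, h⟩)
  have hex : ∀ y ∈ B, ∃ i ∈ P, ∀ g ∈ A.flat x, g ∈ A.flat y → pointOf g (F i) = 0 := fun y hy =>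
    (collinear_or_third hF hP (hB y hy).1).resolve_left (hB y hy).2
  have : Nonempty ι := ⟨x.1.1⟩
  choose! f hfP hf using hex
  refine (Finset.card_le_mul_card_image_of_maps_to hfP 2 fun i hi => ?_)
  by_contra! hlt
  obtain ⟨a, b, c, ha, hb, hc, hab, hac, hbc⟩ := Finset.two_lt_card_iff.1 hlt
  simp only [Finset.mem_filter] at ha hb hc
  refine not_three_of_vanishing hF x ![a, b, c] ?_ ?_ ?_ (i := i) ?_ ?_
  · intro s t
    fin_cases s <;> fin_cases t <;> simp [hab, hac, hbc, hab.symm, hac.symm, hbc.symm]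
  · intro s
    fin_cases s
    exacts [(hB _ ha.1).1, (hB _ hb.1).1, (hB _ hc.1).1]
  · intro s
    fin_cases s
    exacts [(hB _ ha.1).2, (hB _ hb.1).2, (hB _ hc.1).2]
  · rintro rfl
    exact ((hI _).1 x.mem_I).1 hi
  · intro s
    fin_cases s
    · exact ha.2 ▸ hf a ha.1
    · exact hb.2 ▸ hf b hb.1
    · exact hc.2 ▸ hf c hc.1

theorem heavy_or_finrank_le [Fintype ι] [DecidableEq ι] (hF : IsRadicalFamily F p) {P J : Finset ι}
    (hI : ∀ i, i ∈ A.I ↔ i ∉ P ∧ F i ∉ V * V) (hJP : ∀ i ∈ J, i ∉ P)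
    (hJ : ∀ i ∈ J, 2 ≤ (p i).totalDegree) (hcard : 5 * P.card + 4 ≤ J.card)
    (hne : A.I.Nonempty) :
    (∃ o ∈ A.I, ∃ D ⊆ A.I, (∀ i ∈ D, A.c i ∈ Submodule.span ℂ {A.c o}) ∧
      A.I.card ≤ 20 * D.card) ∨
    Module.finrank ℂ (Submodule.span ℂ (A.c '' A.I)) ≤ 291600 := by
  classical
  let cls : A.Pt → Finset A.Pt := fun x =>
    Finset.univ.filter fun y => A.c y.1.1 ∈ Submodule.span ℂ {A.c x.1.1}
  let D : A.Pt → Finset ι := fun x =>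
    A.I.filter fun i => A.c i ∈ Submodule.span ℂ {A.c x.1.1}
  have hcls : ∀ x, (D x).card ≤ (cls x).card ∧ (cls x).card ≤ 2 * (D x).card := fun x =>
    card_filter_pt fun i => A.c i ∈ Submodule.span ℂ {A.c x.1.1}
  have hall : A.I.card ≤ Fintype.card A.Pt := by
    have := (card_filter_pt (A := A) fun _ => True).1
    simpa using this
  by_cases hheavy : ∃ x, Fintype.card A.Pt ≤ 10 * (cls x).card
  · left
    obtain ⟨x, hx⟩ := hheavy
    refine ⟨_, x.mem_I, D x, Finset.filter_subset _ _, fun i hi => (Finset.mem_filter.1 hi).2, ?_⟩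
    have := (hcls x).2
    omega
  right
  push Not at hheavy
  obtain ⟨o, ho⟩ := hne
  obtain ⟨x₀, rfl⟩ := exists_pt ho
  have hlarge : 5 * P.card ≤ 2 * Fintype.card A.Pt := by
    have h1 := servers_bound hF hI ho (D x₀) (fun i hi h => Finset.mem_filter.2 ⟨hi, h⟩)
      (J.filter fun i => F i ∈ V * V) (fun i hi => (Finset.mem_filter.1 hi).2)
    have h2 : (J.filter fun i => F i ∈ V * V).card * 2 ≤
        ∑ i ∈ J.filter fun i => F i ∈ V * V, (p i).totalDegree := by
      rw [← smul_eq_mul, ← Finset.sum_const]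
      exact Finset.sum_le_sum fun i hi => hJ i (Finset.mem_filter.1 hi).1
    have h3 : (J.filter fun i => ¬ F i ∈ V * V).card ≤ A.I.card :=
      Finset.card_le_card fun i hi =>
        (hI i).2 ⟨hJP i (Finset.mem_filter.1 hi).1, (Finset.mem_filter.1 hi).2⟩
    have h4 := Finset.card_filter_add_card_filter_not (s := J) fun i => F i ∈ V * V
    have h5 := (hcls x₀).1
    have h6 := hheavy x₀
    omega
  have hrsg := finrank_span_le_of_collinearTriples A.vec (linearIndependent_vec hF)
    (δ := 1 / 10) (by norm_num) fun x => by
      let B : Finset A.Pt := Finset.univ.filter fun y =>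
        A.c y.1.1 ∉ Submodule.span ℂ {A.c x.1.1} ∧ ¬ ∃ z, CollinearTriple A.vec (x, y, z)
      have hB := card_bad_le hF hI x B fun y hy => (Finset.mem_filter.1 hy).2
      refine ⟨Finset.univ \ (cls x ∪ B), ?_, fun y hy => ?_⟩
      · have h1 := Finset.card_union_le (cls x) B
        have h2 := hheavy x
        have h3 := Finset.card_sdiff_add_card_eq_card (Finset.subset_univ (cls x ∪ B))
        rw [Finset.card_univ] at h3
        have h4 : Fintype.card A.Pt ≤ 10 * (Finset.univ \ (cls x ∪ B)).card := by omega
        have h5 : (Fintype.card A.Pt : ℝ) ≤ 10 * (Finset.univ \ (cls x ∪ B)).card := by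
          exact_mod_cast h4
        linarith
      · simp only [cls, B, Finset.mem_sdiff, Finset.mem_univ, true_and, Finset.mem_union,
          Finset.mem_filter, not_or, not_and, not_not] at hy
        exact hy.2 hy.1
  have hrsg' : Module.finrank ℂ (Submodule.span ℂ (Set.range A.vec)) ≤ 291600 := by
    have : (Module.finrank ℂ (Submodule.span ℂ (Set.range A.vec)) : ℝ) ≤ 291600 := by linarith
    exact_mod_cast this
  have himg : A.c '' A.I =
      LinearMap.fst ℂ (MvPolynomial (Fin n) ℂ) K '' Set.range A.vec := by
    ext l
    constructor
    · rintro ⟨i, hi, rfl⟩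
      obtain ⟨x, rfl⟩ := exists_pt (A := A) hi
      exact ⟨_, ⟨x, rfl⟩, rfl⟩
    · rintro ⟨_, ⟨x, rfl⟩, rfl⟩
      exact ⟨_, x.mem_I, rfl⟩
  rw [himg, Submodule.span_image]
  have : Module.Finite ℂ (Submodule.span ℂ (Set.range A.vec)) :=
    Module.Finite.span_of_finite ℂ (Set.finite_range _)
  exact (Submodule.finrank_map_le _ _).trans hrsg'

end Pencil

instance finite_linForms (n : ℕ) : Module.Finite ℂ (linForms n) := by
  rw [linForms_eq_span]
  exact Module.Finite.span_of_finite ℂ (Set.finite_range _)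

theorem finite_of_le_linForms {n : ℕ} {V : Submodule ℂ (MvPolynomial (Fin n) ℂ)}
    (hV : V ≤ linForms n) : Module.Finite ℂ V :=
  Submodule.finiteDimensional_of_le hV

theorem finrank_sup_span_singleton_le {n : ℕ} {V : Submodule ℂ (MvPolynomial (Fin n) ℂ)}
    (hV : V ≤ linForms n) (c : MvPolynomial (Fin n) ℂ) :
    Module.finrank ℂ ↥(V ⊔ Submodule.span ℂ {c}) ≤ Module.finrank ℂ V + 1 := by
  have := finite_of_le_linForms hV
  refine (Submodule.finrank_add_le_finrank_add_finrank _ _).trans ?_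
  have := finrank_span_le_card (R := ℂ) ({c} : Set (MvPolynomial (Fin n) ℂ))
  simp at this
  omega

namespace IsRadicalFamily

variable {n : ℕ} {ι : Type*} {F p : ι → MvPolynomial (Fin n) ℂ}

/-- The set `I` of members not quadratic in `V` is a positive proportion of the family; either a
positive proportion of `I` shares one further linear form, or `V` can be enlarged by a bounded
dimension so that all members outside `P` become quadratic in it. -/
theorem exists_common_form_or_finrank_le [Fintype ι] [DecidableEq ι] (hF : IsRadicalFamily F p)
    {P J : Finset ι}
    (hJP : ∀ i ∈ J, i ∉ P) (hJ : ∀ i ∈ J, 2 ≤ (p i).totalDegree) (hcard : 5 * P.card + 4 ≤ J.card)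
    {V : Submodule ℂ (MvPolynomial (Fin n) ℂ)} (hVL : V ≤ linForms n)
    (hS : ∀ i, i ∉ P → ∃ c ∈ linForms n,
      F i ∈ (V ⊔ Submodule.span ℂ {c}) * (V ⊔ Submodule.span ℂ {c}))
    (I : Finset ι) (hI : ∀ i, i ∈ I ↔ i ∉ P ∧ F i ∉ V * V) (hne : I.Nonempty) :
    Pᶜ.card ≤ 25 * I.card ∧
    ((∃ c ∈ linForms n, ∃ D ⊆ I, I.card ≤ 20 * D.card ∧
        ∀ i ∈ D, F i ∈ (V ⊔ Submodule.span ℂ {c}) * (V ⊔ Submodule.span ℂ {c})) ∨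
      ∃ W, V ≤ W ∧ W ≤ linForms n ∧ Module.finrank ℂ W ≤ Module.finrank ℂ V + 291600 ∧
        ∀ i, i ∉ P → F i ∈ W * W) := by
  classical
  obtain ⟨K, _, _, A, hA⟩ := exists_pencil hVL P hS
  obtain rfl : I = A.I := by ext i; rw [hI, hA]
  constructor
  · obtain ⟨o, ho⟩ := hne
    have h1 := Pencil.servers_bound hF hA ho A.I (fun i hi _ => hi)
      (Pᶜ.filter fun i => F i ∈ V * V) (fun i hi => (Finset.mem_filter.1 hi).2)
    have h2 : (Pᶜ.filter fun i => F i ∈ V * V).card ≤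
        ∑ i ∈ Pᶜ.filter fun i => F i ∈ V * V, (p i).totalDegree := by
      rw [Finset.card_eq_sum_ones]
      exact Finset.sum_le_sum fun i _ => hF.one_le_totalDegree i
    have h3 : (Pᶜ.filter fun i => ¬ F i ∈ V * V).card ≤ A.I.card :=
      Finset.card_le_card fun i hi =>
        (hA i).2 ⟨by simpa using (Finset.mem_filter.1 hi).1, (Finset.mem_filter.1 hi).2⟩
    have h4 := Finset.card_filter_add_card_filter_not (s := Pᶜ) fun i => F i ∈ V * V
    have h5 : J.card ≤ Pᶜ.card := Finset.card_le_card fun i hi => by simpa using hJP i hi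
    have h6 : 0 < A.I.card := Finset.card_pos.2 ⟨o, ho⟩
    omega
  · rcases Pencil.heavy_or_finrank_le hF hA hJP hJ hcard hne with ⟨o, ho, D, hD, hDo, hc⟩ | h
    · refine Or.inl ⟨A.c o, A.c_mem o ho, D, hD, hc, fun i hi => ?_⟩
      have hle : V ⊔ Submodule.span ℂ {A.c i} ≤ V ⊔ Submodule.span ℂ {A.c o} :=
        sup_le_sup_left ((Submodule.span_singleton_le_iff_mem _ _).2 (hDo i hi)) V
      exact mul_le_mul' hle hle (A.mem i (hD hi))
    · refine Or.inr ⟨V ⊔ Submodule.span ℂ (A.c '' A.I), le_sup_left, sup_le hVL ?_, ?_,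
        fun i hi => ?_⟩
      · rw [Submodule.span_le]
        rintro _ ⟨i, hi, rfl⟩
        exact A.c_mem i hi
      · have := finite_of_le_linForms hVL
        have : Module.Finite ℂ (Submodule.span ℂ (A.c '' A.I)) :=
          Module.Finite.span_of_finite ℂ (A.I.finite_toSet.image _)
        exact (Submodule.finrank_add_le_finrank_add_finrank _ _).trans (by omega)
      · by_cases hiV : F i ∈ V * V
        · exact mul_le_mul' (le_sup_left (a := V)) (le_sup_left (a := V)) hiV
        · have hiI : i ∈ A.I := (hA i).2 ⟨hi, hiV⟩
          have hle : V ⊔ Submodule.span ℂ {A.c i} ≤ V ⊔ Submodule.span ℂ (A.c '' A.I) :=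
            sup_le_sup_left (Submodule.span_mono (by simpa using ⟨i, hiI, rfl⟩)) V
          exact mul_le_mul' hle hle (A.mem i hiI)

theorem exists_forall_mem_mul_of_card [Fintype ι] [DecidableEq ι] (hF : IsRadicalFamily F p)
    {P J : Finset ι}
    (hJP : ∀ i ∈ J, i ∉ P) (hJ : ∀ i ∈ J, 2 ≤ (p i).totalDegree) (hcard : 5 * P.card + 4 ≤ J.card)
    (t s : ℕ) (hts : s + t = 63) :
    ∀ {V : Submodule ℂ (MvPolynomial (Fin n) ℂ)} (_ : V ≤ linForms n)
    (_ : ∀ i, i ∉ P → ∃ c ∈ linForms n,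
      F i ∈ (V ⊔ Submodule.span ℂ {c}) * (V ⊔ Submodule.span ℂ {c}))
    (I : Finset ι) (_ : ∀ i, i ∈ I ↔ i ∉ P ∧ F i ∉ V * V)
    (_ : I.card * 20 ^ s ≤ 19 ^ s * Pᶜ.card),
    ∃ W, V ≤ W ∧ W ≤ linForms n ∧ Module.finrank ℂ W ≤ Module.finrank ℂ V + t + 291600 ∧
      ∀ i, i ∉ P → F i ∈ W * W := by
  classical
  induction t generalizing s with
  | zero =>
    intro V hVL hS I hI hc
    rcases I.eq_empty_or_nonempty with h | hne
    · refine ⟨V, le_rfl, hVL, by omega, fun i hi => ?_⟩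
      by_contra hiV
      have := (hI i).2 ⟨hi, hiV⟩
      simp [h] at this
    · obtain ⟨h1, -⟩ := hF.exists_common_form_or_finrank_le hJP hJ hcard hVL hS I hI hne
      exfalso
      have hpos := Finset.card_pos.2 hne
      obtain rfl : s = 63 := by omega
      have h2 : I.card * 20 ^ 63 ≤ 19 ^ 63 * (25 * I.card) :=
        hc.trans (Nat.mul_le_mul_left _ h1)
      have h3 : (20 ^ 63 : ℕ) ≤ 19 ^ 63 * 25 := by
        refine Nat.le_of_mul_le_mul_left ?_ hpos
        calc _ ≤ _ := h2
          _ = _ := by ring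
      norm_num at h3
  | succ t ih =>
    intro V hVL hS I hI hc
    rcases I.eq_empty_or_nonempty with h | hne
    · refine ⟨V, le_rfl, hVL, by omega, fun i hi => ?_⟩
      by_contra hiV
      have := (hI i).2 ⟨hi, hiV⟩
      simp [h] at this
    obtain ⟨-, ⟨c, hcL, D, hDI, hDc, hD⟩ | ⟨W, h1, h2, h3, h4⟩⟩ :=
      hF.exists_common_form_or_finrank_le hJP hJ hcard hVL hS I hI hne
    · set V' := V ⊔ Submodule.span ℂ {c} with hV'
      have hV'L : V' ≤ linForms n := sup_le hVL (by simpa using hcL)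
      have hI'I : (Finset.univ.filter fun i => i ∉ P ∧ F i ∉ V' * V') ⊆ I \ D := by
        intro i hi
        have hi' := (Finset.mem_filter.1 hi).2
        rw [Finset.mem_sdiff, hI]
        exact ⟨⟨hi'.1, fun h => hi'.2 (mul_le_mul' (le_sup_left (a := V)) (le_sup_left (a := V)) h)⟩,
          fun h => hi'.2 (hD i h)⟩
      have hcI : 20 * (Finset.univ.filter fun i => i ∉ P ∧ F i ∉ V' * V').card ≤ 19 * I.card := by
        have := Finset.card_le_card hI'I
        rw [Finset.card_sdiff_of_subset hDI] at this
        omega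
      obtain ⟨W, h1, h2, h3, h4⟩ := ih (s + 1) (by omega) hV'L (fun i hi => by
        obtain ⟨c', hc'L, hc'⟩ := hS i hi
        have hle : V ⊔ Submodule.span ℂ {c'} ≤ V' ⊔ Submodule.span ℂ {c'} :=
          sup_le_sup_right le_sup_left _
        exact ⟨c', hc'L, mul_le_mul' hle hle hc'⟩)
        (Finset.univ.filter fun i => i ∉ P ∧ F i ∉ V' * V') (fun i => by simp) (by
          calc _ = 20 * (Finset.univ.filter fun i => i ∉ P ∧ F i ∉ V' * V').card * 20 ^ s := by
                ring
            _ ≤ 19 * I.card * 20 ^ s := Nat.mul_le_mul_right _ hcI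
            _ = 19 * (I.card * 20 ^ s) := by ring
            _ ≤ 19 * (19 ^ s * Pᶜ.card) := Nat.mul_le_mul_left _ hc
            _ = _ := by ring)
      have hfr : Module.finrank ℂ V' ≤ _ := finrank_sup_span_singleton_le hVL c
      exact ⟨W, le_sup_left.trans h1, h2, by omega, h4⟩
    · exact ⟨W, h1, h2, by omega, h4⟩

/-- If every member outside a small set `P` is quadratic in `V` and one further linear form, then
all these members are quadratic in a space of linear forms of dimension `dim V + O(1)`. -/
theorem exists_forall_mem_mul [Fintype ι] [DecidableEq ι] (hF : IsRadicalFamily F p)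
    {P J : Finset ι}
    (hJP : ∀ i ∈ J, i ∉ P) (hJ : ∀ i ∈ J, 2 ≤ (p i).totalDegree) (hcard : 5 * P.card + 4 ≤ J.card)
    {V : Submodule ℂ (MvPolynomial (Fin n) ℂ)} (hVL : V ≤ linForms n)
    (hS : ∀ i, i ∉ P → ∃ c ∈ linForms n,
      F i ∈ (V ⊔ Submodule.span ℂ {c}) * (V ⊔ Submodule.span ℂ {c})) :
    ∃ W, V ≤ W ∧ W ≤ linForms n ∧ Module.finrank ℂ W ≤ Module.finrank ℂ V + 63 + 291600 ∧
      ∀ i, i ∉ P → F i ∈ W * W := by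
  classical
  obtain ⟨W, h1, h2, h3, h4⟩ := hF.exists_forall_mem_mul_of_card hJP hJ hcard 63 0 rfl hVL hS
    (Finset.univ.filter fun i => i ∉ P ∧ F i ∉ V * V) (fun i => by simp) (by
      simp only [pow_zero, mul_one, one_mul]
      exact Finset.card_le_card fun i hi => by simpa using (Finset.mem_filter.1 hi).2.1)
  exact ⟨W, h1, h2, h3, h4⟩

/-- The members in `P` are quadratic in the same linear forms as the others. -/
theorem mem_mul_of_forall_mem_mul [Fintype ι] [DecidableEq ι] (hF : IsRadicalFamily F p)
    {P J : Finset ι} (hJP : ∀ i ∈ J, i ∉ P) (hJ : ∀ i ∈ J, 2 ≤ (p i).totalDegree)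
    (hcard : 5 * P.card + 4 ≤ J.card)
    {V : Submodule ℂ (MvPolynomial (Fin n) ℂ)} (hVL : V ≤ linForms n)
    (hV : ∀ i, i ∉ P → F i ∈ V * V) (i : ι) : F i ∈ V * V := by
  by_contra hiV
  have hfin : Module.Finite ℂ (linForms n) := inferInstance
  have hex : ∃ d : ℕ, ∃ H, V ≤ H ∧ H ≤ linForms n ∧ F i ∉ H * H ∧
      Module.finrank ℂ H + d = Module.finrank ℂ (linForms n) := by
    obtain ⟨d, hd⟩ := Nat.exists_eq_add_of_le (Submodule.finrank_mono hVL)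
    exact ⟨d, V, le_rfl, hVL, hiV, hd.symm⟩
  classical
  obtain ⟨H, hVH, hHL, hiH, hd⟩ := Nat.find_spec hex
  have hne : ¬ linForms n ≤ H := fun h => hiH (mul_le_mul' h h (hF.mem i))
  obtain ⟨c, hcL, hcH⟩ := SetLike.not_le_iff_exists.1 hne
  have hHc : H ⊔ Submodule.span ℂ {c} ≤ linForms n := sup_le hHL (by simpa using hcL)
  have hi : F i ∈ (H ⊔ Submodule.span ℂ {c}) * (H ⊔ Submodule.span ℂ {c}) := by
    by_contra hi
    have hfin' := finite_of_le_linForms hHc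
    have hlt : Module.finrank ℂ H < Module.finrank ℂ ↥(H ⊔ Submodule.span ℂ {c}) :=
      Submodule.finrank_lt_finrank_of_lt (lt_of_le_of_ne le_sup_left fun h => hcH (by
        rw [h]; exact Submodule.mem_sup_right (Submodule.mem_span_singleton_self _)))
    obtain ⟨d, hd'⟩ := Nat.exists_eq_add_of_le (Submodule.finrank_mono hHc)
    exact Nat.find_min hex (m := d) (by omega) ⟨_, hVH.trans le_sup_left, hHc, hi, hd'.symm⟩
  have h1 := hF.sum_totalDegree_le_of_servers hHL hcL hcH hi hiH P
    (fun k _ hkP => Or.inl (mul_le_mul' hVH hVH (hV k hkP))) J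
    (fun k hk => mul_le_mul' hVH hVH (hV k (hJP k hk)))
  have h2 : J.card * 2 ≤ ∑ i ∈ J, (p i).totalDegree := by
    rw [← smul_eq_mul, ← Finset.sum_const]
    exact Finset.sum_le_sum hJ
  omega

end IsRadicalFamily

theorem finrank_mul_self_le {A : Type*} [CommRing A] [Algebra ℂ A] (V : Submodule ℂ A)
    [Module.Finite ℂ V] : Module.Finite ℂ ↥(V * V) ∧
      Module.finrank ℂ ↥(V * V) ≤ Module.finrank ℂ V ^ 2 := by
  have h : V * V = LinearMap.range
      ((TensorProduct.lift ((LinearMap.mul ℂ A).compl₁₂ V.subtype V.subtype))) := by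
    apply le_antisymm
    · rw [Submodule.mul_le]
      intro a ha b hb
      exact ⟨(⟨a, ha⟩ : V) ⊗ₜ (⟨b, hb⟩ : V), by simp⟩
    · rintro _ ⟨x, rfl⟩
      induction x with
      | zero => simp
      | tmul a b => simpa using Submodule.mul_mem_mul a.2 b.2
      | add x y hx hy => rw [map_add]; exact add_mem hx hy
  rw [h]
  refine ⟨inferInstance, (LinearMap.finrank_range_le _).trans ?_⟩
  rw [Module.finrank_tensorProduct, pow_two]

/-- The vectors `x` and `y` are linearly independent modulo `W`, witnessed by dual functionals. -/
def IndepMod {E : Type*} [AddCommGroup E] [Module ℂ E] (W : Submodule ℂ E) (x y : E) : Prop :=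
  ∃ f g : E →ₗ[ℂ] ℂ, (∀ w ∈ W, f w = 0 ∧ g w = 0) ∧ f x = 1 ∧ f y = 0 ∧ g x = 0 ∧ g y = 1

namespace IndepMod

section

variable {E : Type*} [AddCommGroup E] [Module ℂ E] {W : Submodule ℂ E} {x y : E}

theorem mem_or_mem_of_not (h : ¬ IndepMod W x y) : x ∈ W ∨ y ∈ W ⊔ Submodule.span ℂ {x} := by
  by_contra! hcon
  obtain ⟨f, hfW, hfx⟩ := exists_functional W hcon.1
  obtain ⟨g, hgW, hgy⟩ := exists_functional _ hcon.2
  have hgx : g x = 0 := hgW x (Submodule.mem_sup_right (Submodule.mem_span_singleton_self _))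
  have hgW' : ∀ w ∈ W, g w = 0 := fun w hw => hgW w (Submodule.mem_sup_left hw)
  exact h ⟨f - f y • g, g, fun w hw => by simp [hfW w hw, hgW' w hw], by simp [hfx, hgx],
    by simp [hgy], hgx, hgy⟩

theorem exists_form_of_not (h : ¬ IndepMod W x y) {L : Submodule ℂ E} (hx : x ∈ L) (hy : y ∈ L) :
    ∃ c ∈ L, x ∈ W ⊔ Submodule.span ℂ {c} ∧ y ∈ W ⊔ Submodule.span ℂ {c} := by
  rcases mem_or_mem_of_not h with h | h
  · exact ⟨y, hy, Submodule.mem_sup_left h,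
      Submodule.mem_sup_right (Submodule.mem_span_singleton_self _)⟩
  · exact ⟨x, hx, Submodule.mem_sup_right (Submodule.mem_span_singleton_self _), h⟩

theorem exists_combination_of_not (h : ¬ IndepMod W x y) :
    ∃ a b : ℂ, (a ≠ 0 ∨ b ≠ 0) ∧ a • x + b • y ∈ W := by
  rcases mem_or_mem_of_not h with h | h
  · exact ⟨1, 0, Or.inl one_ne_zero, by simpa using h⟩
  · obtain ⟨w, hw, u, hu, huw⟩ := Submodule.mem_sup.1 h
    obtain ⟨a, rfl⟩ := Submodule.mem_span_singleton.1 hu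
    refine ⟨-a, 1, Or.inr one_ne_zero, ?_⟩
    rw [← huw]
    simpa using hw

theorem combination_notMem (h : IndepMod W x y) {a b : ℂ} (hab : a ≠ 0 ∨ b ≠ 0) :
    a • x + b • y ∉ W := by
  obtain ⟨f, g, hk, hfx, hfy, hgx, hgy⟩ := h
  intro hm
  have h1 := (hk _ hm).1
  have h2 := (hk _ hm).2
  simp [hfx, hfy, hgx, hgy] at h1 h2
  tauto

end

variable {n : ℕ} {x y : MvPolynomial (Fin n) ℂ} {f g : MvPolynomial (Fin n) ℂ →ₗ[ℂ] ℂ}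

/-- The linear forms killed by both functionals. -/
noncomputable def common (f g : MvPolynomial (Fin n) ℂ →ₗ[ℂ] ℂ) :
    Submodule ℂ (MvPolynomial (Fin n) ℂ) :=
  linForms n ⊓ (LinearMap.ker f ⊓ LinearMap.ker g)

theorem mem_common {l : MvPolynomial (Fin n) ℂ} :
    l ∈ common f g ↔ l ∈ linForms n ∧ f l = 0 ∧ g l = 0 := by
  simp [common]

theorem exists_linear_decomposition (hx : x ∈ linForms n) (hy : y ∈ linForms n) (hfx : f x = 1)
    (hfy : f y = 0) (hgx : g x = 0) (hgy : g y = 1) {l : MvPolynomial (Fin n) ℂ}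
    (hl : l ∈ linForms n) : ∃ (a b : ℂ), ∃ h ∈ common f g, l = a • x + b • y + h := by
  refine ⟨f l, g l, l - (f l • x + g l • y), mem_common.2 ⟨?_, ?_, ?_⟩, by abel⟩
  · exact Submodule.sub_mem _ hl (Submodule.add_mem _ (Submodule.smul_mem _ _ hx)
      (Submodule.smul_mem _ _ hy))
  · simp [hfx, hfy]
  · simp [hgx, hgy]

theorem exists_quadratic_decomposition (hx : x ∈ linForms n) (hy : y ∈ linForms n) (hfx : f x = 1)
    (hfy : f y = 0) (hgx : g x = 0) (hgy : g y = 1) {F : MvPolynomial (Fin n) ℂ}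
    (hF : F ∈ linForms n * linForms n) :
    ∃ (e₁ e₂ e₃ : ℂ), ∃ l₁ ∈ common f g, ∃ l₂ ∈ common f g, ∃ q ∈ common f g * common f g,
      F = C e₁ * x ^ 2 + C e₂ * y ^ 2 + C e₃ * (x * y) + l₁ * x + l₂ * y + q := by
  have hle : linForms n ≤ (common f g ⊔ Submodule.span ℂ {x}) ⊔ Submodule.span ℂ {y} := by
    intro l hl
    obtain ⟨a, b, h, hh, rfl⟩ := exists_linear_decomposition hx hy hfx hfy hgx hgy hl
    refine Submodule.add_mem _ (Submodule.add_mem _ ?_ ?_) ?_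
    · exact Submodule.mem_sup_left (Submodule.mem_sup_right
        (Submodule.smul_mem _ _ (Submodule.mem_span_singleton_self _)))
    · exact Submodule.mem_sup_right (Submodule.smul_mem _ _ (Submodule.mem_span_singleton_self _))
    · exact Submodule.mem_sup_left (Submodule.mem_sup_left hh)
  obtain ⟨e₂, l, G, hl, hG, rfl⟩ := exists_decomposition _ y (mul_le_mul' hle hle hF)
  obtain ⟨e₁, l₁, q, hl₁, hq, rfl⟩ := exists_decomposition _ x hG
  obtain ⟨l₂, hl₂, u, hu, rfl⟩ := Submodule.mem_sup.1 hl
  obtain ⟨e₃, rfl⟩ := Submodule.mem_span_singleton.1 hu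
  refine ⟨e₁, e₂, e₃, l₁, hl₁, l₂, hl₂, q, hq, ?_⟩
  simp only [smul_eq_C_mul]
  ring

theorem quadratic_decomposition_eq_zero (hx : x ∈ linForms n) (hy : y ∈ linForms n) (hfx : f x = 1)
    (hgx : g x = 0) (hgy : g y = 1) {e₁ e₂ e₃ : ℂ}
    {l₁ l₂ q : MvPolynomial (Fin n) ℂ} (hl₁ : l₁ ∈ common f g) (hl₂ : l₂ ∈ common f g)
    (hq : q ∈ common f g * common f g)
    (h : C e₁ * x ^ 2 + C e₂ * y ^ 2 + C e₃ * (x * y) + l₁ * x + l₂ * y + q = 0) :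
    e₁ = 0 ∧ e₂ = 0 ∧ e₃ = 0 ∧ l₁ = 0 ∧ l₂ = 0 ∧ q = 0 := by
  have hfix : ∀ l ∈ common f g, scaleAlong f x 1 l = l ∧ scaleAlong g y 1 l = l := fun l hl => by
    obtain ⟨h1, h2, h3⟩ := mem_common.1 hl
    rw [scaleAlong_apply f x 1 h1, scaleAlong_apply g y 1 h1, h2, h3]
    simp
  have hqf : scaleAlong f x 1 q = q :=
    algHom_eq_of_mem_mul (ψ := AlgHom.id ℂ _) (fun l hl => (hfix l hl).1) hq
  have hqg : scaleAlong g y 1 q = q :=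
    algHom_eq_of_mem_mul (ψ := AlgHom.id ℂ _) (fun l hl => (hfix l hl).2) hq
  have hxg : scaleAlong g y 1 x = x := by rw [scaleAlong_apply g y 1 hx, hgx]; simp
  have hC : ∀ e, scaleAlong g y 1 (C e) = C e := fun e => (scaleAlong g y 1).commutes e
  obtain ⟨h2, h3, h4⟩ := decomposition_eq_zero (e := e₂) (l := C e₃ * x + l₂)
    (g := C e₁ * x ^ 2 + l₁ * x + q) hy hgy
    (by simp only [map_add, map_mul, hC, hxg, (hfix _ hl₂).2])
    (by simp only [map_add, map_mul, map_pow, hC, hxg, (hfix _ hl₁).2, hqg]) (by rw [← h]; ring)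
  obtain ⟨h5, h6, h7⟩ := decomposition_eq_zero hx hfx (hfix _ hl₁).1 hqf h4
  have h8 := congrArg f h3
  rw [← smul_eq_C_mul] at h8
  simp [hfx, (mem_common.1 hl₂).2.1] at h8
  refine ⟨h5, h2, h8, h6, ?_, h7⟩
  rw [h8] at h3
  simpa using h3

/-- A product of two linear forms of the shape `α x y + q`, where `q` is quadratic in `W`
and `x`, `y` are independent modulo `W`, has `q = 0`. -/
theorem eq_zero_of_mul_eq {W : Submodule ℂ (MvPolynomial (Fin n) ℂ)} (hW : W ≤ linForms n)
    (hind : IndepMod W x y) (hx : x ∈ linForms n) (hy : y ∈ linForms n) {q : MvPolynomial (Fin n) ℂ}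
    (hq : q ∈ W * W) {α : ℂ} (hα : α ≠ 0) {a b : MvPolynomial (Fin n) ℂ} (ha : a ∈ linForms n)
    (hb : b ∈ linForms n) (h : a * b = α • (x * y) + q) : q = 0 := by
  obtain ⟨f, g, hk, hfx, hfy, hgx, hgy⟩ := hind
  have hWc : W ≤ common f g := fun w hw => mem_common.2 ⟨hW hw, hk w hw⟩
  obtain ⟨a₁, a₂, a₀, ha₀, rfl⟩ := exists_linear_decomposition hx hy hfx hfy hgx hgy ha
  obtain ⟨b₁, b₂, b₀, hb₀, rfl⟩ := exists_linear_decomposition hx hy hfx hfy hgx hgy hb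
  obtain ⟨h1, h2, h3, h4, h5, h6⟩ := quadratic_decomposition_eq_zero (e₁ := a₁ * b₁) (e₂ := a₂ * b₂)
    (e₃ := a₁ * b₂ + a₂ * b₁ - α) (l₁ := a₁ • b₀ + b₁ • a₀) (l₂ := a₂ • b₀ + b₂ • a₀)
    (q := a₀ * b₀ - q) hx hy hfx hgx hgy
    (Submodule.add_mem _ (Submodule.smul_mem _ _ hb₀) (Submodule.smul_mem _ _ ha₀))
    (Submodule.add_mem _ (Submodule.smul_mem _ _ hb₀) (Submodule.smul_mem _ _ ha₀))
    (Submodule.sub_mem _ (Submodule.mul_mem_mul ha₀ hb₀) (mul_le_mul' hWc hWc hq)) (by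
      simp only [smul_eq_C_mul, map_sub, map_add, map_mul] at h ⊢
      linear_combination h)
  rw [← sub_eq_zero.1 h6]
  rcases mul_eq_zero.1 h1 with h0 | h0
  · have hb1 : b₁ ≠ 0 := by rintro rfl; apply hα; simp [h0] at h3; exact h3
    rw [h0] at h4
    have : a₀ = 0 := by simpa [hb1] using h4
    rw [this, zero_mul]
  · have ha1 : a₁ ≠ 0 := by rintro rfl; apply hα; simp [h0] at h3; exact h3
    rw [h0] at h4
    have : b₀ = 0 := by simpa [ha1] using h4
    rw [this, mul_zero]

end IndepMod

theorem quartic_eq_zero {K : Type*} [Field K] {a₀ a₁ a₂ a₃ a₄ : K}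
    (h : Polynomial.C a₄ * Polynomial.X ^ 4 + Polynomial.C a₃ * Polynomial.X ^ 3 +
      Polynomial.C a₂ * Polynomial.X ^ 2 + Polynomial.C a₁ * Polynomial.X +
      Polynomial.C a₀ = 0) : a₄ = 0 ∧ a₃ = 0 ∧ a₂ = 0 ∧ a₁ = 0 ∧ a₀ = 0 := by
  have hcoeff := fun m => congrArg (fun q : Polynomial K => q.coeff m) h
  refine ⟨?_, ?_, ?_, ?_, ?_⟩
  · simpa [Polynomial.coeff_X, Polynomial.coeff_C] using hcoeff 4
  · simpa [Polynomial.coeff_X, Polynomial.coeff_C] using hcoeff 3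
  · simpa [Polynomial.coeff_X, Polynomial.coeff_C] using hcoeff 2
  · simpa [Polynomial.coeff_X, Polynomial.coeff_C] using hcoeff 1
  · simpa [Polynomial.coeff_X, Polynomial.coeff_C] using hcoeff 0

namespace IsRadicalFamily

variable {n : ℕ} {ι : Type*} {F p : ι → MvPolynomial (Fin n) ℂ}

theorem not_smul (hF : IsRadicalFamily F p) {i k : ι} (hik : i ≠ k) (γ : ℂ) : F k ≠ γ • F i :=
  fun h => hF.not_dvd i k hik (h ▸ (hF.dvd i).trans (Dvd.intro (C γ) (by
    rw [smul_eq_C_mul, mul_comm])))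

theorem exists_mem_span_pair [Finite ι] (hF : IsRadicalFamily F p)
    {V : Submodule ℂ (MvPolynomial (Fin n) ℂ)}
    (hVL : V ≤ linForms n) {o : ι} (ho : F o ∈ V * V) {j k : ι} (hjk : j ≠ k) (hok : k ≠ o)
    (hk : p k = F k)
    {x y a b : MvPolynomial (Fin n) ℂ} (hx : x ∈ linForms n) (hy : y ∈ linForms n)
    (ha : a ∈ linForms n) (hb : b ∈ linForms n)
    (hj : F j = F o + x * y) (hk' : F k = F o + a * b)
    (hind : IndepMod (V ⊔ Submodule.span ℂ {a, b}) x y) :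
    ∃ i, i ≠ j ∧ i ≠ k ∧ ∃ α γ : ℂ, F i = α • F j + γ • F k := by
  obtain ⟨f, g, hkill, hfx, hfy, hgx, hgy⟩ := hind
  obtain ⟨K, _, _, _, φ, hφ⟩ := exists_generic_point_of_prime (hF.prime k)
  rw [hk] at hφ
  have hchar : CharZero K := charZero_of_injective_algebraMap (algebraMap ℂ K).injective
  have hφo : φ (F o) ≠ 0 := fun h => hF.not_dvd k o hok (hk ▸ (hφ _).1 h)
  set W := V ⊔ Submodule.span ℂ {a, b} with hW
  have hWL : W ≤ linForms n := sup_le hVL (Submodule.span_le.2 (by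
    rintro _ (rfl | rfl)
    exacts [ha, hb]))
  have haW : a ∈ W := Submodule.mem_sup_right (Submodule.subset_span (by simp))
  have hbW : b ∈ W := Submodule.mem_sup_right (Submodule.subset_span (by simp))
  have hoW : F o ∈ W * W := mul_le_mul' (le_sup_left (a := V)) (le_sup_left (a := V)) ho
  have hkW : F k ∈ W * W := hk' ▸ Submodule.add_mem _ hoW (Submodule.mul_mem_mul haW hbW)
  let P : ℕ → (MvPolynomial (Fin n) ℂ →ₗ[ℂ] K) := fun s =>
    shift (shift φ.toLinearMap f (-φ (F o) / (s + 1) - φ x)) g ((s + 1 : K) - φ y)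
  have hs : ∀ s : ℕ, (s + 1 : K) ≠ 0 := fun s => Nat.cast_add_one_ne_zero s
  have hPc : ∀ s, ∀ l, f l = 0 → g l = 0 → P s l = φ l := fun s l h1 h2 => by
    simp [P, h1, h2]
  have hPW : ∀ s, ∀ l ∈ W, P s l = φ l := fun s l hl => hPc s l (hkill l hl).1 (hkill l hl).2
  have hPx : ∀ s, P s x = -φ (F o) / (s + 1) := fun s => by simp [P, hfx, hgx]
  have hPy : ∀ s, P s y = s + 1 := fun s => by simp [P, hfy, hgy]
  have hthird : ∀ s, ∃ i, i ≠ j ∧ i ≠ k ∧ pointOf (P s) (F i) = 0 := fun s => by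
    refine hF.third (pointOf (P s)) j k hjk ?_ ?_
    · rw [hj, map_add, map_mul, pointOf_apply_of_mem _ hx, pointOf_apply_of_mem _ hy, hPx, hPy,
        pointOf_eq_of_mem_mul _ φ hWL (hPW s) hoW]
      field_simp [hs s]
      ring
    · rw [pointOf_eq_of_mem_mul _ φ hWL (hPW s) hkW]
      exact (hφ _).2 dvd_rfl
  choose i hij hik hi using hthird
  obtain ⟨i₀, hi₀⟩ := Finite.exists_infinite_fiber i
  have hinf : (i ⁻¹' {i₀}).Infinite := Set.infinite_coe_iff.1 hi₀
  have hne : i₀ ≠ j ∧ i₀ ≠ k := by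
    obtain ⟨s, hs⟩ := hinf.nonempty
    obtain rfl : i s = i₀ := hs
    exact ⟨hij s, hik s⟩
  refine ⟨i₀, hne.1, hne.2, ?_⟩
  obtain ⟨e₁, e₂, α, l₁, hl₁, l₂, hl₂, q, hq, hFi⟩ :=
    IndepMod.exists_quadratic_decomposition hx hy hfx hfy hgx hgy (hF.mem i₀)
  have hcL : IndepMod.common f g ≤ linForms n := fun l hl => (IndepMod.mem_common.1 hl).1
  have hPcommon : ∀ s, ∀ l ∈ IndepMod.common f g, P s l = φ l := fun s l hl =>
    hPc s l (IndepMod.mem_common.1 hl).2.1 (IndepMod.mem_common.1 hl).2.2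
  set Θ : Polynomial K := Polynomial.C (algebraMap ℂ K e₂) * Polynomial.X ^ 4 +
    Polynomial.C (φ l₂) * Polynomial.X ^ 3 +
    Polynomial.C (φ q - algebraMap ℂ K α * φ (F o)) * Polynomial.X ^ 2 +
    Polynomial.C (-(φ l₁ * φ (F o))) * Polynomial.X +
    Polynomial.C (algebraMap ℂ K e₁ * φ (F o) ^ 2) with hΘ
  have hroot : ∀ s ∈ i ⁻¹' {i₀}, Θ.eval (s + 1 : K) = 0 := by
    intro s hsi
    obtain rfl : i s = i₀ := hsi
    have h := hi s
    have hCe : ∀ e : ℂ, pointOf (P s) (C e) = algebraMap ℂ K e := fun e =>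
      (pointOf (P s)).commutes e
    rw [hFi] at h
    simp only [map_add, map_mul, map_pow, hCe, pointOf_apply_of_mem _ hx,
      pointOf_apply_of_mem _ hy, pointOf_apply_of_mem _ (hcL hl₁),
      pointOf_apply_of_mem _ (hcL hl₂), hPcommon s _ hl₁, hPcommon s _ hl₂, hPx, hPy,
      pointOf_eq_of_mem_mul _ φ hcL (hPcommon s) hq] at h
    have h' := congrArg (fun z => z * (s + 1 : K) ^ 2) h
    simp only [zero_mul] at h'
    rw [← h']
    simp only [hΘ, Polynomial.eval_add, Polynomial.eval_mul, Polynomial.eval_C,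
      Polynomial.eval_pow, Polynomial.eval_X]
    field_simp [hs s]
    ring
  have hΘ0 : Θ = 0 := by
    refine Polynomial.eq_zero_of_infinite_isRoot Θ
      ((hinf.image (f := fun s : ℕ => (s + 1 : K)) ?_).mono ?_)
    · intro s _ t _ hst
      exact_mod_cast add_right_cancel hst
    · rintro _ ⟨s, hs, rfl⟩
      exact hroot s hs
  obtain ⟨c4, c3, c2, c1, c0⟩ := quartic_eq_zero hΘ0
  have hFk2 := isHomogeneous_of_mem_linForms_mul (hF.mem k)
  have hlin : ∀ l ∈ linForms n, φ l = 0 → l = 0 := fun l hl h => by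
    by_contra h0
    have := degree_le_of_dvd h0 hFk2 hl ((hφ l).1 h)
    omega
  have he₁ : e₁ = 0 := by simpa [hφo] using c0
  have he₂ : e₂ = 0 := by simpa using c4
  have hl₁0 : l₁ = 0 := hlin l₁ (hcL hl₁) (by simpa [hφo] using c1)
  have hl₂0 : l₂ = 0 := hlin l₂ (hcL hl₂) c3
  obtain ⟨γ, hγ⟩ := exists_smul_eq_of_dvd (F := q - α • F o) (hF.ne_zero k) hFk2
    (isHomogeneous_of_mem_linForms_mul (Submodule.sub_mem _ (mul_le_mul' hcL hcL hq)
      (Submodule.smul_mem _ _ (hF.mem o)))) ((hφ _).1 (by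
        rw [map_sub, map_smul, Algebra.smul_def, c2]))
  refine ⟨α, γ, ?_⟩
  rw [← hγ, hj, hFi, he₁, he₂, hl₁0, hl₂0]
  simp only [smul_eq_C_mul, map_zero]
  ring

/-- A member `F i` lies on at most one line through `F j` and another member `F k`. -/
theorem eq_of_mem_span_pair (hF : IsRadicalFamily F p) {V : Submodule ℂ (MvPolynomial (Fin n) ℂ)}
    (hVL : V ≤ linForms n) {o : ι} (ho : F o ∈ V * V) {j k k' i : ι} (hij : i ≠ j) (hok : k ≠ o)
    {x y a b a' b' : MvPolynomial (Fin n) ℂ} (hx : x ∈ linForms n) (hy : y ∈ linForms n)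
    (ha : a ∈ linForms n) (hb : b ∈ linForms n) (ha' : a' ∈ linForms n) (hb' : b' ∈ linForms n)
    (hj : F j = F o + x * y) (hk : F k = F o + a * b) {ε : ℂ} (hk' : F k' = ε • F o + a' * b')
    (hind : IndepMod (V ⊔ Submodule.span ℂ {a, b}) x y) {α γ α' γ' : ℂ}
    (h : F i = α • F j + γ • F k) (h' : F i = α' • F j + γ' • F k') : k = k' := by
  set W := V ⊔ Submodule.span ℂ {a, b} with hW
  have hWL : W ≤ linForms n := sup_le hVL (Submodule.span_le.2 (by
    rintro _ (rfl | rfl)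
    exacts [ha, hb]))
  have haW : a ∈ W := Submodule.mem_sup_right (Submodule.subset_span (by simp))
  have hbW : b ∈ W := Submodule.mem_sup_right (Submodule.subset_span (by simp))
  have hoW : F o ∈ W * W := mul_le_mul' (le_sup_left (a := V)) (le_sup_left (a := V)) ho
  have hγ : γ ≠ 0 := by
    rintro rfl
    exact hF.not_smul hij.symm α (by rw [h]; simp)
  have hγ' : γ' ≠ 0 := by
    rintro rfl
    exact hF.not_smul hij.symm α' (by rw [h']; simp)
  by_cases hα : α = α'
  · by_contra hkk
    refine hF.not_smul hkk (γ'⁻¹ * γ) ?_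
    rw [h, hα] at h'
    rw [mul_smul, add_left_cancel h', smul_smul, inv_mul_cancel₀ hγ', one_smul]
  · exfalso
    have hq := IndepMod.eq_zero_of_mul_eq hWL hind hx hy
      (q := (α - α' + γ - γ' * ε) • F o + γ • (a * b))
      (Submodule.add_mem _ (Submodule.smul_mem _ _ hoW)
        (Submodule.smul_mem _ _ (Submodule.mul_mem_mul haW hbW))) (sub_ne_zero.2 hα)
      (Submodule.smul_mem _ γ' ha') hb' (by
        rw [h, hj, hk, hk'] at h'
        simp only [smul_eq_C_mul, map_sub, map_add, map_mul] at h' ⊢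
        linear_combination -h')
    refine hF.not_smul hok.symm (1 - γ⁻¹ * (α - α' + γ - γ' * ε)) ?_
    have hab : a * b = -(γ⁻¹ * (α - α' + γ - γ' * ε)) • F o := by
      have := eq_neg_of_add_eq_zero_right hq
      rw [neg_smul, mul_smul, ← smul_neg, ← this, smul_smul, inv_mul_cancel₀ hγ, one_smul]
    rw [hk, hab, sub_smul, one_smul, neg_smul, ← sub_eq_add_neg]

end IsRadicalFamily

namespace IsRadicalFamily

variable {n : ℕ} {ι : Type*} {F p : ι → MvPolynomial (Fin n) ℂ}

open Classical in
theorem card_indepMod_le [Fintype ι] (hF : IsRadicalFamily F p) {P J : Finset ι}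
    {V : Submodule ℂ (MvPolynomial (Fin n) ℂ)} (hVL : V ≤ linForms n) {o : ι} (ho : F o ∈ V * V)
    {a b : ι → MvPolynomial (Fin n) ℂ} (ha : ∀ i, a i ∈ linForms n) (hb : ∀ i, b i ∈ linForms n)
    {ε : ι → ℂ} (hP : ∀ i, i ∉ P → F i = ε i • F o + a i * b i)
    (hJ : ∀ j ∈ J, j ∉ P ∧ j ≠ o ∧ p j = F j ∧ F j = F o + a j * b j) {j : ι} (hj : j ∈ J) :
    (J.filter fun k => IndepMod (V ⊔ Submodule.span ℂ {a k, b k}) (a j) (b j)).card ≤ P.card := by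
  have : Nonempty ι := ⟨j⟩
  obtain ⟨hjP, hjo, -, hjF⟩ := hJ j hj
  have hex : ∀ k ∈ J.filter fun k => IndepMod (V ⊔ Submodule.span ℂ {a k, b k}) (a j) (b j),
      ∃ i ∈ P, ∃ α γ : ℂ, F i = α • F j + γ • F k := by
    intro k hk
    obtain ⟨hkJ, hind⟩ := Finset.mem_filter.1 hk
    obtain ⟨hkP, hko, hkp, hkF⟩ := hJ k hkJ
    have hjk : j ≠ k := by
      rintro rfl
      refine hind.combination_notMem (a := 1) (b := 0) (Or.inl one_ne_zero) ?_
      rw [one_smul, zero_smul, add_zero]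
      exact Submodule.mem_sup_right (Submodule.subset_span (by simp))
    obtain ⟨i, hij, hik, α, γ, h⟩ := hF.exists_mem_span_pair hVL ho hjk hko hkp (ha j) (hb j)
      (ha k) (hb k) hjF hkF hind
    refine ⟨i, ?_, α, γ, h⟩
    by_contra hiP
    exact hik.symm (hF.eq_of_mem_span_pair hVL ho hij hko (ha j) (hb j) (ha k) (hb k) (ha i) (hb i)
      hjF hkF (hP i hiP) hind h (α' := 0) (γ' := 1) (by simp))
  choose! i hiP α γ hi using hex
  refine Finset.card_le_card_of_injOn i hiP ?_
  intro k hk k' hk' hkk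
  obtain ⟨hkJ, hind⟩ := Finset.mem_filter.1 hk
  obtain ⟨hkJ', -⟩ := Finset.mem_filter.1 hk'
  obtain ⟨hkP, hko, hkp, hkF⟩ := hJ k hkJ
  refine hF.eq_of_mem_span_pair hVL ho ?_ hko (ha j) (hb j) (ha k) (hb k) (ha k') (hb k')
    hjF hkF (hP k' (hJ k' hkJ').1) hind (hi k hk) (hkk ▸ hi k' hk')
  rintro h
  exact hjP (h ▸ hiP k hk)

theorem finrank_sup_span_pair_le {V : Submodule ℂ (MvPolynomial (Fin n) ℂ)}
    (hVL : V ≤ linForms n) (x y : MvPolynomial (Fin n) ℂ) :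
    Module.finrank ℂ ↥(V ⊔ Submodule.span ℂ {x, y}) ≤ Module.finrank ℂ V + 2 := by
  classical
  have := finite_of_le_linForms hVL
  have : Module.Finite ℂ (Submodule.span ℂ ({x, y} : Set (MvPolynomial (Fin n) ℂ))) :=
    Module.Finite.span_of_finite ℂ (Set.toFinite _)
  refine (Submodule.finrank_add_le_finrank_add_finrank _ _).trans ?_
  have h := finrank_span_finset_le_card (R := ℂ) ({x, y} : Finset (MvPolynomial (Fin n) ℂ))
  have h2 : ({x, y} : Finset (MvPolynomial (Fin n) ℂ)).card ≤ 2 := Finset.card_le_two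
  rw [Finset.coe_insert, Finset.coe_singleton] at h
  have h3 : Module.finrank ℂ (Submodule.span ℂ ({x, y} : Set (MvPolynomial (Fin n) ℂ))) ≤ 2 :=
    le_trans h h2
  omega

theorem finrank_lt_sup_span_singleton {V : Submodule ℂ (MvPolynomial (Fin n) ℂ)}
    (hVL : V ≤ linForms n) {u : MvPolynomial (Fin n) ℂ} (hu : u ∉ V) :
    Module.finrank ℂ V < Module.finrank ℂ ↥(V ⊔ Submodule.span ℂ {u}) := by
  have := finite_of_le_linForms hVL
  exact Submodule.finrank_lt_finrank_of_lt (lt_of_le_of_ne le_sup_left fun h => hu (by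
    rw [h]; exact Submodule.mem_sup_right (Submodule.mem_span_singleton_self _)))

/-- After enlarging `V` by at most four dimensions, each member `F j = F o + a j * b j` becomes
quadratic in `V` and one further linear form. -/
theorem exists_forall_exists_form [Fintype ι] (hF : IsRadicalFamily F p) {P J : Finset ι}
    {V : Submodule ℂ (MvPolynomial (Fin n) ℂ)} (hVL : V ≤ linForms n) {o : ι} (ho : F o ∈ V * V)
    {a b : ι → MvPolynomial (Fin n) ℂ} (ha : ∀ i, a i ∈ linForms n) (hb : ∀ i, b i ∈ linForms n)
    {ε : ι → ℂ} (hP : ∀ i, i ∉ P → F i = ε i • F o + a i * b i)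
    (hJ : ∀ j ∈ J, j ∉ P ∧ j ≠ o ∧ p j = F j ∧ F j = F o + a j * b j)
    (hcard : 3 * P.card < J.card) :
    ∃ W, V ≤ W ∧ W ≤ linForms n ∧ Module.finrank ℂ W ≤ Module.finrank ℂ V + 4 ∧
      ∀ j ∈ J, ∃ c ∈ linForms n,
        a j ∈ W ⊔ Submodule.span ℂ {c} ∧ b j ∈ W ⊔ Submodule.span ℂ {c} := by
  classical
  by_contra! hcon
  have hnext : ∀ W, V ≤ W → W ≤ linForms n → Module.finrank ℂ W ≤ Module.finrank ℂ V + 4 →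
      ∃ j ∈ J, IndepMod W (a j) (b j) := by
    intro W h1 h2 h3
    obtain ⟨j, hj, hjc⟩ := hcon W h1 h2 h3
    refine ⟨j, hj, ?_⟩
    by_contra hn
    obtain ⟨c, hcL, hca, hcb⟩ := IndepMod.exists_form_of_not hn (ha j) (hb j)
    exact hjc c hcL hca hcb
  have hpair : ∀ W, W ≤ linForms n → ∀ j, W ⊔ Submodule.span ℂ {a j, b j} ≤ linForms n :=
    fun W hW j => sup_le hW (Submodule.span_le.2 (by
      rintro _ (rfl | rfl)
      exacts [ha j, hb j]))
  obtain ⟨j₁, hj₁, i₁⟩ := hnext V le_rfl hVL (by omega)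
  set V₁ := V ⊔ Submodule.span ℂ {a j₁, b j₁} with hV₁
  have hV₁L : V₁ ≤ linForms n := hpair V hVL j₁
  have hVV₁ : V ≤ V₁ := le_sup_left
  have d₁ : Module.finrank ℂ V₁ ≤ _ := finrank_sup_span_pair_le hVL (a j₁) (b j₁)
  obtain ⟨j₂, hj₂, i₂⟩ := hnext V₁ hVV₁ hV₁L (by omega)
  set V₂ := V₁ ⊔ Submodule.span ℂ {a j₂, b j₂} with hV₂
  have hV₂L : V₂ ≤ linForms n := hpair V₁ hV₁L j₂
  have hVV₂ : V₁ ≤ V₂ := le_sup_left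
  have d₂ : Module.finrank ℂ V₂ ≤ _ := finrank_sup_span_pair_le hV₁L (a j₂) (b j₂)
  obtain ⟨j₃, hj₃, i₃⟩ := hnext V₂ (hVV₁.trans hVV₂) hV₂L (by omega)
  let B : ι → Finset ι := fun j =>
    J.filter fun k => IndepMod (V ⊔ Submodule.span ℂ {a k, b k}) (a j) (b j)
  have hB : ∀ j ∈ J, (B j).card ≤ P.card := fun j hj =>
    hF.card_indepMod_le hVL ho ha hb hP hJ hj
  have hcardB : (B j₁ ∪ B j₂ ∪ B j₃).card < J.card := by
    have h1 := Finset.card_union_le (B j₁ ∪ B j₂) (B j₃)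
    have h2 := Finset.card_union_le (B j₁) (B j₂)
    have := hB j₁ hj₁
    have := hB j₂ hj₂
    have := hB j₃ hj₃
    omega
  obtain ⟨k, hkJ, hkB⟩ := Finset.exists_mem_notMem_of_card_lt_card hcardB
  simp only [B, Finset.mem_union, Finset.mem_filter, hkJ, true_and, not_or] at hkB
  obtain ⟨⟨n₁, n₂⟩, n₃⟩ := hkB
  obtain ⟨r₁, s₁, h₁, m₁⟩ := IndepMod.exists_combination_of_not n₁
  obtain ⟨r₂, s₂, h₂, m₂⟩ := IndepMod.exists_combination_of_not n₂
  obtain ⟨r₃, s₃, h₃, m₃⟩ := IndepMod.exists_combination_of_not n₃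
  have hmem : ∀ (W : Submodule ℂ (MvPolynomial (Fin n) ℂ)) (r s : ℂ) (j : ι),
      r • a j + s • b j ∈ W ⊔ Submodule.span ℂ {a j, b j} := fun W r s j =>
    Submodule.mem_sup_right (Submodule.mem_span_pair.2 ⟨r, s, rfl⟩)
  have u₁ := i₁.combination_notMem h₁
  have u₂ := i₂.combination_notMem h₂
  have u₃ := i₃.combination_notMem h₃
  set U₁ := V ⊔ Submodule.span ℂ {r₁ • a j₁ + s₁ • b j₁} with hU₁
  set U₂ := U₁ ⊔ Submodule.span ℂ {r₂ • a j₂ + s₂ • b j₂} with hU₂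
  set U₃ := U₂ ⊔ Submodule.span ℂ {r₃ • a j₃ + s₃ • b j₃} with hU₃
  have hUV₁ : U₁ ≤ V₁ := sup_le hVV₁ (by
    rw [Submodule.span_singleton_le_iff_mem]; exact hmem _ _ _ _)
  have hUV₂ : U₂ ≤ V₂ := sup_le (hUV₁.trans hVV₂) (by
    rw [Submodule.span_singleton_le_iff_mem]; exact hmem _ _ _ _)
  have hU₃ : U₃ ≤ V ⊔ Submodule.span ℂ {a k, b k} :=
    sup_le (sup_le (sup_le le_sup_left (by simpa using m₁)) (by simpa using m₂)) (by simpa using m₃)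
  have e₁ : _ < Module.finrank ℂ U₁ := finrank_lt_sup_span_singleton hVL u₁
  have e₂ : _ < Module.finrank ℂ U₂ :=
    finrank_lt_sup_span_singleton (hUV₁.trans hV₁L) fun h => u₂ (hUV₁ h)
  have e₃ : _ < Module.finrank ℂ U₃ :=
    finrank_lt_sup_span_singleton (hUV₂.trans hV₂L) fun h => u₃ (hUV₂ h)
  have hfin := finite_of_le_linForms (hpair V hVL k)
  have e₄ := Submodule.finrank_mono hU₃
  have e₅ := finrank_sup_span_pair_le hVL (a k) (b k)
  omega

end IsRadicalFamily

theorem irreducible_of_isHomogeneous_one {n : ℕ} {l : MvPolynomial (Fin n) ℂ}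
    (hl : l.IsHomogeneous 1) (h0 : l ≠ 0) : Irreducible l := by
  refine irreducible_of_totalDegree_eq_one (hl.totalDegree h0) fun x hx => ?_
  refine isUnit_iff_ne_zero.2 fun hx0 => h0 ?_
  ext d
  simpa [hx0] using hx d

theorem not_smul_of_linearIndependent_pair {E : Type*} [AddCommGroup E] [Module ℂ E] {x y : E}
    (h : LinearIndependent ℂ ![x, y]) (γ : ℂ) : y ≠ γ • x := fun hy => by
  have := (LinearIndependent.pair_iff.1 h) γ (-1) (by rw [hy]; simp)
  simp at this

/-- The prime factors of the members of a `(Q_o,m₁,m₂)`-set. -/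
noncomputable def QoPrime {n m₁ m₂ r : ℕ} (Qo : MvPolynomial (Fin n) ℂ)
    (Qs : Fin m₁ → MvPolynomial (Fin n) ℂ) (Ps : Fin m₂ → MvPolynomial (Fin n) ℂ)
    (ls : Fin r → MvPolynomial (Fin n) ℂ) :
    Unit ⊕ Fin m₁ ⊕ Fin m₂ ⊕ Fin r → MvPolynomial (Fin n) ℂ :=
  Sum.elim (fun _ => Qo) (Sum.elim Qs (Sum.elim Ps ls))

/-- Irreducible quadratics and squares of linear forms, pairwise independent and satisfying the
radical-membership condition, form a radical family. -/
theorem IsRadicalFamily.of_radical {n : ℕ} {ι : Type*} [Fintype ι] [DecidableEq ι]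
    {F p : ι → MvPolynomial (Fin n) ℂ}
    (hFp : ∀ i, (F i).IsHomogeneous 2 ∧ Irreducible (F i) ∧ p i = F i ∨
      (p i).IsHomogeneous 1 ∧ F i = p i ^ 2)
    (h0 : ∀ i, F i ≠ 0)
    (hind : ∀ i j, i ≠ j → LinearIndependent ℂ ![F i, F j])
    (hrad : ∀ i j, i ≠ j →
      (∏ k ∈ (Finset.univ.erase i).erase j, F k) ∈ (Ideal.span {F i, F j}).radical) :
    IsRadicalFamily F p where
  mem i := by
    rcases hFp i with h | h
    · exact h.1.mem_linForms_mul
    · rw [h.2, sq]; exact Submodule.mul_mem_mul h.1 h.1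
  prime i := by
    rcases hFp i with h | h
    · rw [h.2.2]; exact h.2.1.prime
    · refine (irreducible_of_isHomogeneous_one h.1 fun hp => h0 i ?_).prime
      rw [h.2, hp]; simp
  eq_or i := (hFp i).imp (fun h => h.2.2) id
  not_dvd i k hik hdvd := by
    have hns := fun γ => not_smul_of_linearIndependent_pair (hind i k hik) γ
    rcases hFp i with h | h
    · have hk : (F k).IsHomogeneous 2 := by
        rcases hFp k with h' | h'
        · exact h'.1
        · rw [h'.2]; exact h'.1.pow 2
      rw [h.2.2] at hdvd
      obtain ⟨γ, hγ⟩ := exists_smul_eq_of_dvd (h0 i) h.1 hk hdvd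
      exact hns γ hγ
    · have hp0 : p i ≠ 0 := fun hp => h0 i (by rw [h.2, hp]; simp)
      have hirr := irreducible_of_isHomogeneous_one h.1 hp0
      rcases hFp k with h' | h'
      · have hass : F k ∣ p i := (hirr.dvd_symm h'.2.1 hdvd)
        have := degree_le_of_dvd hp0 h'.1 h.1 hass
        omega
      · rw [h'.2] at hdvd
        obtain ⟨γ, hγ⟩ := exists_smul_eq_of_dvd hp0 h.1 h'.1 (hirr.prime.dvd_of_dvd_pow hdvd)
        exact hns (γ ^ 2) (by rw [h'.2, hγ, h.2, smul_pow])
  third φ i k hik hi hk := by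
    obtain ⟨N, hN⟩ := hrad i k hik
    have hker : Ideal.span {F i, F k} ≤ RingHom.ker φ := by
      rw [Ideal.span_le]
      rintro x (rfl | rfl)
      · exact hi
      · exact hk
    have h1 := hker hN
    rw [RingHom.mem_ker, map_pow] at h1
    have h2 := eq_zero_of_pow_eq_zero h1
    rw [map_prod, Finset.prod_eq_zero_iff] at h2
    obtain ⟨l, hl, hl0⟩ := h2
    simp only [Finset.mem_erase, Finset.mem_univ, and_true] at hl
    exact ⟨l, hl.2, hl.1, hl0⟩

theorem exists_mem_mul_of_rankS {n : ℕ} {Q : MvPolynomial (Fin n) ℂ} (h : rankS Q ≠ 0) :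
    ∃ V ≤ linForms n, Module.finrank ℂ V ≤ 2 * rankS Q ∧ Q ∈ V * V := by
  obtain ⟨a, b, ha, hb, hQ⟩ := Nat.sInf_mem (Nat.nonempty_of_pos_sInf (Nat.pos_of_ne_zero h))
  refine ⟨Submodule.span ℂ (Set.range (Sum.elim a b)), ?_, ?_, ?_⟩
  · rw [Submodule.span_le]
    rintro _ ⟨i | i, rfl⟩
    · exact ha i
    · exact hb i
  · have := finrank_range_le_card (R := ℂ) (Sum.elim a b)
    rw [Fintype.card_sum, Fintype.card_fin] at this
    rw [two_mul]
    exact this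
  · refine Set.mem_of_eq_of_mem hQ ?_
    exact Submodule.sum_mem _ fun i _ => Submodule.mul_mem_mul
      (Submodule.subset_span ⟨Sum.inl i, rfl⟩) (Submodule.subset_span ⟨Sum.inr i, rfl⟩)

theorem IsQoSet.isRadicalFamily {n m₁ m₂ r : ℕ} {Qo : MvPolynomial (Fin n) ℂ}
    {Qs : Fin m₁ → MvPolynomial (Fin n) ℂ} {Ps : Fin m₂ → MvPolynomial (Fin n) ℂ}
    {ls : Fin r → MvPolynomial (Fin n) ℂ} (h : IsQoSet m₁ m₂ r Qo Qs Ps ls) :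
    IsRadicalFamily (QoFam Qo Qs Ps ls) (QoPrime Qo Qs Ps ls) := by
  obtain ⟨ho, hQ, hP, hl, hind, hrad, -⟩ := h
  refine IsRadicalFamily.of_radical ?_ ?_ hind hrad
  · rintro (i | i | i | i)
    · exact Or.inl ⟨ho.1, ho.2, rfl⟩
    · exact Or.inl ⟨(hQ i).1, (hQ i).2, rfl⟩
    · exact Or.inl ⟨(hP i).1, (hP i).2, rfl⟩
    · exact Or.inr ⟨hl i, rfl⟩
  · rintro (i | i)
    · exact ho.2.ne_zero
    · exact (hind (Sum.inr i) (Sum.inl ()) (by simp)).ne_zero 0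

/-- Claim 5.15 of the paper, low-rank case. For every `R ≥ 2` there is a
constant `c(R)` bounding the dimension of the span of every `(Q_o,m₁,m₂)`-set with
`2 ≤ rank_s(Q_o) ≤ R`. -/
theorem statement14 :
    ∀ R : ℕ, 2 ≤ R → ∃ c : ℕ, ∀ (n m₁ m₂ r : ℕ) (Qo : MvPolynomial (Fin n) ℂ)
      (Qs : Fin m₁ → MvPolynomial (Fin n) ℂ) (Ps : Fin m₂ → MvPolynomial (Fin n) ℂ)
      (ls : Fin r → MvPolynomial (Fin n) ℂ),
      IsQoSet m₁ m₂ r Qo Qs Ps ls → 2 ≤ rankS Qo → rankS Qo ≤ R →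
      Module.finrank ℂ (Submodule.span ℂ (Set.range (QoFam Qo Qs Ps ls))) ≤ c := by
  intro R _
  refine ⟨(2 * R + 4 + 63 + 291600) ^ 2, ?_⟩
  intro n m₁ m₂ r Qo Qs Ps ls h hrank hR
  have hF := h.isRadicalFamily
  obtain ⟨ho, hQ, -, hl, -, -, hm, hab, -⟩ := h
  obtain ⟨V, hVL, hVr, hoV⟩ := exists_mem_mul_of_rankS (Q := Qo) (by omega)
  choose a b ha hb hQab using hab
  let P : Finset (Unit ⊕ Fin m₁ ⊕ Fin m₂ ⊕ Fin r) :=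
    Finset.univ.image fun i => Sum.inr (Sum.inr (Sum.inl i))
  let J : Finset (Unit ⊕ Fin m₁ ⊕ Fin m₂ ⊕ Fin r) :=
    Finset.univ.image fun j => Sum.inr (Sum.inl j)
  have hPc : P.card = m₂ := by
    rw [Finset.card_image_of_injective _ fun x y hxy => by simpa using hxy, Finset.card_univ,
      Fintype.card_fin]
  have hJc : J.card = m₁ := by
    rw [Finset.card_image_of_injective _ fun x y hxy => by simpa using hxy, Finset.card_univ,
      Fintype.card_fin]
  have hoJ : Sum.inl () ∉ J := by simp [J]
  obtain ⟨W, hVW, hWL, hWr, hW⟩ := hF.exists_forall_exists_form (P := P) (J := J) hVL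
    (o := Sum.inl ()) hoV
    (a := Sum.elim (fun _ => 0) (Sum.elim a (Sum.elim (fun _ => 0) ls)))
    (b := Sum.elim (fun _ => 0) (Sum.elim b (Sum.elim (fun _ => 0) ls)))
    (by
      rintro (i | i | i | i)
      exacts [Submodule.zero_mem _, ha i, Submodule.zero_mem _, hl i])
    (by
      rintro (i | i | i | i)
      exacts [Submodule.zero_mem _, hb i, Submodule.zero_mem _, hl i])
    (ε := Sum.elim (fun _ => 1) (Sum.elim (fun _ => 1) fun _ => 0))
    (by
      rintro (i | i | i | i) hi
      · simp [QoFam]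
      · simpa [QoFam] using hQab i
      · exact absurd (Finset.mem_image_of_mem _ (Finset.mem_univ i)) hi
      · simp [QoFam, sq])
    (by
      intro j hj
      obtain ⟨j, -, rfl⟩ := Finset.mem_image.1 hj
      exact ⟨by simp [P], by simp, rfl, hQab j⟩)
    (by omega)
  have hJP : ∀ i ∈ insert (Sum.inl ()) J, i ∉ P := by
    intro i hi
    rcases Finset.mem_insert.1 hi with rfl | hi
    · simp [P]
    · obtain ⟨j, -, rfl⟩ := Finset.mem_image.1 hi
      simp [P]
  have hJd : ∀ i ∈ insert (Sum.inl ()) J, 2 ≤ (QoPrime Qo Qs Ps ls i).totalDegree := by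
    intro i hi
    rcases Finset.mem_insert.1 hi with rfl | hi
    · exact (ho.1.totalDegree ho.2.ne_zero).ge
    · obtain ⟨j, -, rfl⟩ := Finset.mem_image.1 hi
      exact ((hQ j).1.totalDegree (hQ j).2.ne_zero).ge
  have hcard : 5 * P.card + 4 ≤ (insert (Sum.inl ()) J).card := by
    rw [Finset.card_insert_of_notMem hoJ]; omega
  have hmono : ∀ c, Qo ∈ (W ⊔ Submodule.span ℂ {c}) * (W ⊔ Submodule.span ℂ {c}) := fun c =>
    mul_le_mul' (hVW.trans le_sup_left) (hVW.trans le_sup_left) hoV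
  obtain ⟨U, -, hUL, hUr, hU⟩ := hF.exists_forall_mem_mul hJP hJd hcard hWL (by
    rintro (i | i | i | i) hi
    · exact ⟨0, Submodule.zero_mem _, hmono 0⟩
    · obtain ⟨c, hc, hac, hbc⟩ :=
        hW (Sum.inr (Sum.inl i)) (Finset.mem_image_of_mem _ (Finset.mem_univ i))
      refine ⟨c, hc, ?_⟩
      change Qs i ∈ _
      rw [hQab i]
      exact Submodule.add_mem _ (hmono c) (Submodule.mul_mem_mul hac hbc)
    · exact absurd (Finset.mem_image_of_mem _ (Finset.mem_univ i)) hi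
    · have := Submodule.mem_sup_right (S := W) (Submodule.mem_span_singleton_self (R := ℂ) (ls i))
      refine ⟨ls i, hl i, ?_⟩
      change ls i ^ 2 ∈ _
      rw [sq]
      exact Submodule.mul_mem_mul this this)
  have hall := hF.mem_mul_of_forall_mem_mul hJP hJd hcard hUL hU
  have := finite_of_le_linForms hUL
  obtain ⟨hfin, hUU⟩ := finrank_mul_self_le U
  have hle : Submodule.span ℂ (Set.range (QoFam Qo Qs Ps ls)) ≤ U * U := by
    rw [Submodule.span_le]
    rintro _ ⟨i, rfl⟩
    exact hall i
  refine ((Submodule.finrank_mono hle).trans hUU).trans (Nat.pow_le_pow_left (hUr.trans ?_) 2)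
  gcongr
  exact hWr.trans (by omega)
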